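/- Suppose m ≥ n > 2 and A = i_1 i_2 ⋯ i_n ⊆ [m] with {1,2,3} ≺ A. Then VR(F^m_{⪯A}, 2) ≃ ( ∨_{r_A} S³ ) ∨ VR(F^m_{≺A}, 2). Consequently, for any A ⊆ [m] with |A| ≥ 3, the complex VR(F^m_{⪯A}, 2) is homotopy equivalent to a wedge sum of Σ{r_B : {1,2,3} ⪯ B ⪯ A} copies of the 3-sphere S³. -/

import Mathlib

open Finset

/-- An abstract simplicial complex on a vertex type `V`: a collection of nonempty
finite subsets of `V` (the faces), closed under taking nonempty subsets. -/
structure AbsSC (V : Type) where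
  faces : Set (Finset V)
  not_empty_mem : ∅ ∉ faces
  down_closed : ∀ s ∈ faces, ∀ t : Finset V, t ⊆ s → t ≠ ∅ → t ∈ faces

namespace AbsSC

variable {V W : Type}

/-- The vertex set of a simplicial complex. -/
def vertices (K : AbsSC V) : Set V := {v | ({v} : Finset V) ∈ K.faces}

/-- The geometric realization of a simplicial complex: the space of convex weightings
supported on a face, topologized as a subspace of `V → ℝ`. -/
def space (K : AbsSC V) : Type :=
  {f : V → ℝ // (∀ v, 0 ≤ f v) ∧ ∃ s ∈ K.faces, (∀ v, f v ≠ 0 → v ∈ s) ∧ ∑ v ∈ s, f v = 1}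

instance (K : AbsSC V) : TopologicalSpace K.space := by unfold space; infer_instance

/-- `L` is a subcomplex of `K`. -/
def IsSubcomplex (L K : AbsSC V) : Prop := L.faces ⊆ K.faces

/-- Homotopy equivalence of simplicial complexes (of their geometric realizations). -/
def HEquiv (K : AbsSC V) (L : AbsSC W) : Prop :=
  Nonempty (ContinuousMap.HomotopyEquiv K.space L.space)

/-- The realization of `K` is homotopy equivalent to the topological space `X`. -/
def HEquivTop (K : AbsSC V) (X : Type) [TopologicalSpace X] : Prop :=
  Nonempty (ContinuousMap.HomotopyEquiv K.space X)

/-- The inclusion of realizations induced by a subcomplex inclusion. -/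
def incl {L K : AbsSC V} (h : L.faces ⊆ K.faces) : C(L.space, K.space) where
  toFun f := ⟨f.1, f.2.1, by obtain ⟨s, hs, h1, h2⟩ := f.2.2; exact ⟨s, h hs, h1, h2⟩⟩
  continuous_toFun := Continuous.subtype_mk continuous_subtype_val _

variable [DecidableEq V]

/-- The link of a vertex. -/
def link (K : AbsSC V) (v : V) : AbsSC V where
  faces := {σ | σ ≠ ∅ ∧ v ∉ σ ∧ σ ∪ {v} ∈ K.faces}
  not_empty_mem h := h.1 rfl
  down_closed := by
    rintro s ⟨hne, hv, hs⟩ t hts htne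
    exact ⟨htne, fun hvt => hv (hts hvt),
      K.down_closed _ hs _ (Finset.union_subset_union hts (Finset.Subset.refl _)) (by simp [Finset.union_eq_empty])⟩

lemma link_subset (K : AbsSC V) (v : V) : (K.link v).faces ⊆ K.faces := by
  rintro σ ⟨hne, hv, hσ⟩
  exact K.down_closed _ hσ _ Finset.subset_union_left hne

/-- The complex induced on the vertices other than `v`. -/
def delete (K : AbsSC V) (v : V) : AbsSC V where
  faces := {σ | σ ∈ K.faces ∧ v ∉ σ}
  not_empty_mem h := K.not_empty_mem h.1
  down_closed := by
    rintro s ⟨hs, hv⟩ t hts htne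
    exact ⟨K.down_closed _ hs _ hts htne, fun h => hv (hts h)⟩

/-- The star of a vertex: `st_K(v) = {σ : σ ∪ {v} ∈ K}`. -/
def star (K : AbsSC V) (v : V) : AbsSC V where
  faces := {σ | σ ≠ ∅ ∧ σ ∪ {v} ∈ K.faces}
  not_empty_mem h := h.1 rfl
  down_closed := by
    rintro s ⟨hne, hs⟩ t hts htne
    exact ⟨htne,
      K.down_closed _ hs _ (Finset.union_subset_union hts (Finset.Subset.refl _)) (by simp [Finset.union_eq_empty])⟩

/-- The star cluster of a subcomplex `L` in `K`: the union of stars of vertices of `L`. -/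
def starCluster (K L : AbsSC V) : AbsSC V where
  faces := {σ | σ ≠ ∅ ∧ ∃ v, ({v} : Finset V) ∈ L.faces ∧ σ ∪ {v} ∈ K.faces}
  not_empty_mem h := h.1 rfl
  down_closed := by
    rintro s ⟨hne, v, hvL, hs⟩ t hts htne
    exact ⟨htne, v, hvL,
      K.down_closed _ hs _ (Finset.union_subset_union hts (Finset.Subset.refl _)) (by simp [Finset.union_eq_empty])⟩

/-- The union of two simplicial complexes. -/
def union (K₁ K₂ : AbsSC V) : AbsSC V where
  faces := K₁.faces ∪ K₂.faces
  not_empty_mem h := by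
    rcases h with h | h
    exacts [K₁.not_empty_mem h, K₂.not_empty_mem h]
  down_closed := by
    rintro s (hs | hs) t hts htne
    exacts [Or.inl (K₁.down_closed _ hs _ hts htne), Or.inr (K₂.down_closed _ hs _ hts htne)]

/-- The union of a family of simplicial complexes. -/
def iUnionC {ι : Type} (F : ι → AbsSC V) : AbsSC V where
  faces := ⋃ i, (F i).faces
  not_empty_mem h := by
    obtain ⟨i, hi⟩ := Set.mem_iUnion.mp h
    exact (F i).not_empty_mem hi
  down_closed := by
    intro s hs t hts htne
    obtain ⟨i, hi⟩ := Set.mem_iUnion.mp hs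
    exact Set.mem_iUnion.mpr ⟨i, (F i).down_closed _ hi _ hts htne⟩

/-- The `n`-skeleton of a complex: all faces with at most `n+1` vertices. -/
def skeleton (K : AbsSC V) (n : ℕ) : AbsSC V where
  faces := {σ | σ ∈ K.faces ∧ σ.card ≤ n + 1}
  not_empty_mem h := K.not_empty_mem h.1
  down_closed := by
    rintro s ⟨hs, hcard⟩ t hts htne
    exact ⟨K.down_closed _ hs _ hts htne, le_trans (Finset.card_le_card hts) hcard⟩

/-- The simplicial complex generated by a single simplex `s` (all its nonempty subsets). -/
def simplexCx (s : Finset V) : AbsSC V where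
  faces := {t | t ≠ ∅ ∧ t ⊆ s}
  not_empty_mem h := h.1 rfl
  down_closed := by
    rintro a ⟨hne, has⟩ t hta htne
    exact ⟨htne, hta.trans has⟩

/-- A maximal simplex (facet) of `K`. -/
def IsFacet (K : AbsSC V) (σ : Finset V) : Prop :=
  σ ∈ K.faces ∧ ∀ τ ∈ K.faces, σ ⊆ τ → τ = σ

/-- `K` is a clique complex: any nonempty set of vertices which pairwise span edges is a face. -/
def IsCliqueCx (K : AbsSC V) : Prop :=
  ∀ σ : Finset V, σ ≠ ∅ → (∀ v ∈ σ, ({v} : Finset V) ∈ K.faces) →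
    (∀ v ∈ σ, ∀ w ∈ σ, v ≠ w → ({v, w} : Finset V) ∈ K.faces) → σ ∈ K.faces

/-- `L` is a full subcomplex of `K`. -/
def IsFull (L K : AbsSC V) : Prop :=
  ∀ σ ∈ K.faces, (∀ v ∈ σ, ({v} : Finset V) ∈ L.faces) → σ ∈ L.faces

end AbsSC

noncomputable section

/-- The `n`-dimensional sphere. -/
abbrev Sph (n : ℕ) : Type := Metric.sphere (0 : EuclideanSpace ℝ (Fin (n + 1))) 1

/-- A base point on the sphere. -/
def sphBase (n : ℕ) : Sph n :=
  ⟨EuclideanSpace.single 0 1, by simp⟩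

/-- Relation gluing the base points of `c` copies of a pointed space to an auxiliary point. -/
inductive wedgeRel (c : ℕ) (X : Type) (x₀ : X) : Unit ⊕ Fin c × X → Unit ⊕ Fin c × X → Prop
  | glue (i : Fin c) : wedgeRel c X x₀ (Sum.inl ()) (Sum.inr (i, x₀))

/-- The wedge sum of `c` copies of the pointed space `(X, x₀)`. -/
def Wedge (c : ℕ) (X : Type) [TopologicalSpace X] (x₀ : X) : Type := Quot (wedgeRel c X x₀)

instance (c : ℕ) (X : Type) [TopologicalSpace X] (x₀ : X) : TopologicalSpace (Wedge c X x₀) := by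
  unfold Wedge; infer_instance

/-- The base point of the wedge. -/
def wedgePt (c : ℕ) (X : Type) [TopologicalSpace X] (x₀ : X) : Wedge c X x₀ :=
  Quot.mk _ (Sum.inl ())

/-- The wedge sum of `c` copies of the `n`-sphere. -/
abbrev WedgeSph (n c : ℕ) : Type := Wedge c (Sph n) (sphBase n)

/-- The base point of a wedge of spheres. -/
def wedgeSphPt (n c : ℕ) : WedgeSph n c := wedgePt c _ _

/-- Relation gluing the two base points in a binary wedge. -/
inductive wedge2Rel (X Y : Type) (x₀ : X) (y₀ : Y) : X ⊕ Y → X ⊕ Y → Prop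
  | glue : wedge2Rel X Y x₀ y₀ (Sum.inl x₀) (Sum.inr y₀)

/-- The wedge sum `X ∨ Y` of two pointed spaces. -/
def Wedge2 (X Y : Type) [TopologicalSpace X] [TopologicalSpace Y] (x₀ : X) (y₀ : Y) : Type :=
  Quot (wedge2Rel X Y x₀ y₀)

instance (X Y : Type) [TopologicalSpace X] [TopologicalSpace Y] (x₀ : X) (y₀ : Y) :
    TopologicalSpace (Wedge2 X Y x₀ y₀) := by unfold Wedge2; infer_instance

/-- Relation collapsing the top and bottom of the cylinder `X × [0,1]` to two cone points. -/
inductive suspRel (X : Type) : X × unitInterval ⊕ Bool → X × unitInterval ⊕ Bool → Prop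
  | zero (x : X) : suspRel X (Sum.inl (x, 0)) (Sum.inr false)
  | one (x : X) : suspRel X (Sum.inl (x, 1)) (Sum.inr true)

/-- The (unreduced) suspension `Σ X`. -/
def Susp (X : Type) [TopologicalSpace X] : Type := Quot (suspRel X)

instance (X : Type) [TopologicalSpace X] : TopologicalSpace (Susp X) := by
  unfold Susp; infer_instance

/-- The north cone point of the suspension. -/
def suspNorth (X : Type) [TopologicalSpace X] : Susp X := Quot.mk _ (Sum.inr true)

end

/-- The Vietoris–Rips complex at scale `r` of a collection `F` of finite subsets of `ℕ`,
with respect to the symmetric difference metric `d(A,B) = |A Δ B|`. -/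
def VRc (F : Set (Finset ℕ)) (r : ℕ) : AbsSC (Finset ℕ) where
  faces := {σ | σ.Nonempty ∧ (∀ A ∈ σ, A ∈ F) ∧
    ∀ A ∈ σ, ∀ B ∈ σ, (symmDiff A B).card ≤ r}
  not_empty_mem h := by simpa using h.1
  down_closed := by
    rintro s ⟨hne, hF, hd⟩ t hts htne
    exact ⟨Finset.nonempty_iff_ne_empty.mpr htne, fun A hA => hF A (hts hA),
      fun A hA B hB => hd A (hts hA) B (hts hB)⟩

/-- `F_n^m`: all `n`-element subsets of `[m] = {1, …, m}`. -/
def Fnm (m n : ℕ) : Set (Finset ℕ) := {A | A ⊆ Finset.Icc 1 m ∧ A.card = n}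

/-- `F_{≤ n}^m`: all subsets of `[m]` of cardinality at most `n`. -/
def Fle (m n : ℕ) : Set (Finset ℕ) := {A | A ⊆ Finset.Icc 1 m ∧ A.card ≤ n}

/-- The simplex `N[C] = {A : C ⊆ A, |A \ C| = 1}` inside `[m]`. -/
def NSimp (m : ℕ) (C : Finset ℕ) : Finset (Finset ℕ) :=
  (Finset.Icc 1 m \ C).image (fun x => insert x C)

/-- The simplex `L[S]`: all subsets of `S` obtained by removing one element. -/
def LSimp (S : Finset ℕ) : Finset (Finset ℕ) := S.image (fun x => S.erase x)

/-- The total order `≺`: first compare cardinalities, then compare the increasing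
enumerations lexicographically. -/
def precLT (A B : Finset ℕ) : Prop :=
  A.card < B.card ∨
    (A.card = B.card ∧ List.Lex (· < ·) (A.sort (· ≤ ·)) (B.sort (· ≤ ·)))

/-- `A ⪯ B`. -/
def precLE (A B : Finset ℕ) : Prop := precLT A B ∨ A = B

/-- `F^m_{≺ A}`: all subsets of `[m]` strictly preceding `A`. -/
def FprecLT (m : ℕ) (A : Finset ℕ) : Set (Finset ℕ) :=
  {B | B ⊆ Finset.Icc 1 m ∧ precLT B A}

/-- `F^m_{⪯ A}`: all subsets of `[m]` preceding (or equal to) `A`. -/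
def FprecLE (m : ℕ) (A : Finset ℕ) : Set (Finset ℕ) :=
  {B | B ⊆ Finset.Icc 1 m ∧ precLE B A}

/-- The `j`-th value (0-indexed) of an enumeration `i : Fin n → ℕ`. -/
def ith {n : ℕ} (i : Fin n → ℕ) (j : ℕ) : ℕ := if h : j < n then i ⟨j, h⟩ else 0

/-- The `ℓ`-th entry (1-indexed) of the enumeration, as an integer, with `i_0 = -1`. -/
def ivZ {n : ℕ} (i : Fin n → ℕ) (ℓ : ℕ) : ℤ := if ℓ = 0 then -1 else (ith i (ℓ - 1) : ℤ)

/-- For `B = i_1 i_2 ⋯ i_n` (increasing), with `d_1 = i_1` and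
`d_ℓ = i_ℓ - (i_{ℓ-1} + 1)`, `r_B = Σ_{k=2}^{n-2} C(k,2) + Σ_{ℓ=1}^{n-2} d_ℓ·C(n-ℓ,2)`. -/
def rA (B : Finset ℕ) : ℕ :=
  (∑ k ∈ Finset.Icc 2 (B.card - 2), Nat.choose k 2) +
    ∑ ℓ ∈ Finset.Icc 1 (B.card - 2),
      ((B.sort (· ≤ ·)).getD (ℓ - 1) 0 -
        (if ℓ = 1 then 0 else (B.sort (· ≤ ·)).getD (ℓ - 2) 0 + 1)) * Nat.choose (B.card - ℓ) 2

/-- For `B = i_1 i_2 ⋯ i_n` (increasing), with `c_1 = i_1 - 1` and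
`c_ℓ = i_ℓ - (i_{ℓ-1} + 1)`, `s_B = Σ_{k=2}^{n-2} C(k,2) + Σ_{ℓ=1}^{n-2} c_ℓ·C(n-ℓ,2)`. -/
def sA (B : Finset ℕ) : ℕ :=
  (∑ k ∈ Finset.Icc 2 (B.card - 2), Nat.choose k 2) +
    ∑ ℓ ∈ Finset.Icc 1 (B.card - 2),
      ((B.sort (· ≤ ·)).getD (ℓ - 1) 0 -
        (if ℓ = 1 then 1 else (B.sort (· ≤ ·)).getD (ℓ - 2) 0 + 1)) * Nat.choose (B.card - ℓ) 2

/-- `t_n = Σ_{A ⊆ [m], |A| = n} r_A`. -/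
def tN (m n : ℕ) : ℕ :=
  ∑ A ∈ (Finset.Icc 1 m).powerset.filter (fun A => A.card = n), rA A

/-- `o_{m,n} = Σ { s_A : A ∈ F^m_{n+2}, min A ≥ 2 }`. -/
def omn (m n : ℕ) : ℕ :=
  ∑ A ∈ (Finset.Icc 1 m).powerset.filter (fun A => A.card = n + 2 ∧ ∀ x ∈ A, 2 ≤ x), sA A
section PointedEquivalence

variable {X Y Z : Type} [TopologicalSpace X] [TopologicalSpace Y] [TopologicalSpace Z]

/-- Pointed homotopy equivalence of the pointed spaces `(X, x)` and `(Y, y)`. -/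
def PtHEquiv (x : X) (y : Y) : Prop :=
  ∃ (f : C(X, Y)) (g : C(Y, X)), f x = y ∧ g y = x ∧
    (g.comp f).HomotopicRel (ContinuousMap.id X) {x} ∧
    (f.comp g).HomotopicRel (ContinuousMap.id Y) {y}

namespace PtHEquiv

lemma symm {x : X} {y : Y} (h : PtHEquiv x y) : PtHEquiv y x := by
  obtain ⟨f, g, hf, hg, h1, h2⟩ := h
  exact ⟨g, f, hg, hf, h2, h1⟩

lemma of_homeomorph (e : X ≃ₜ Y) (x : X) : PtHEquiv x (e x) :=
  ⟨e, e.symm, rfl, by simp, by simpa using ContinuousMap.HomotopicRel.refl _,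
    by simpa using ContinuousMap.HomotopicRel.refl _⟩

lemma homotopicRel_comp_comp {x : X} {y : Y} {f : C(X, Y)} {g : C(Y, X)} {k : C(Y, Y)}
    (hf : f x = y) (hgf : (g.comp f).HomotopicRel (ContinuousMap.id X) {x})
    (hk : k.HomotopicRel (ContinuousMap.id Y) {y}) :
    (g.comp (k.comp f)).HomotopicRel (ContinuousMap.id X) {x} := by
  refine ContinuousMap.HomotopicRel.trans ?_ hgf
  obtain ⟨H⟩ := hk
  refine ⟨⟨⟨⟨fun p => g (H (p.1, f p.2)), by fun_prop⟩, ?_, ?_⟩, ?_⟩⟩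
  · intro a; simp
  · intro a; simp
  · rintro t a rfl
    have := H.eq_fst t (x := f a) (by simp [hf])
    simp [this]

lemma trans {x : X} {y : Y} {z : Z} (h : PtHEquiv x y) (h' : PtHEquiv y z) : PtHEquiv x z := by
  obtain ⟨f, g, hf, hg, h1, h2⟩ := h
  obtain ⟨f', g', hf', hg', h1', h2'⟩ := h'
  refine ⟨f'.comp f, g.comp g', by simp [hf, hf'], by simp [hg, hg'], ?_, ?_⟩
  · exact homotopicRel_comp_comp hf h1 h1'
  · exact homotopicRel_comp_comp hg' h2' h2

lemma nonempty_homotopyEquiv {x : X} {y : Y} (h : PtHEquiv x y) :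
    Nonempty (ContinuousMap.HomotopyEquiv X Y) := by
  obtain ⟨f, g, -, -, h1, h2⟩ := h
  exact ⟨⟨f, g, h1.homotopic, h2.homotopic⟩⟩

end PtHEquiv

end PointedEquivalence

/-- `X` is obtained from `Y` by attaching, for every `i`, a cone over `S` along `f (i, ·)`. -/
structure ConeAttachment {ι S Y : Type} [TopologicalSpace ι] [TopologicalSpace S]
    [TopologicalSpace Y] (f : C(ι × S, Y)) (X : Type) [TopologicalSpace X] where
  /-- The inclusion of the base space. -/
  base : C(Y, X)
  /-- The parametrization of the attached cones. -/
  cone : C((ι × S) × unitInterval, X)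
  cone_zero : ∀ p, cone (p, 0) = base (f p)
  cone_one : ∀ i s s', cone ((i, s), 1) = cone ((i, s'), 1)
  surj : ∀ x, (∃ y, base y = x) ∨ ∃ p, cone p = x
  lift : ∀ {Z : Type} [TopologicalSpace Z] (a : C(Y, Z)) (b : C((ι × S) × unitInterval, Z)),
    (∀ p, b (p, 0) = a (f p)) → (∀ i s s', b ((i, s), 1) = b ((i, s'), 1)) →
    ∃ F : C(X, Z), (∀ y, F (base y) = a y) ∧ ∀ p, F (cone p) = b p

namespace ConeAttachment

variable {ι S Y X X' Z : Type} [TopologicalSpace ι] [TopologicalSpace S] [TopologicalSpace Y]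
  [TopologicalSpace X] [TopologicalSpace X'] [TopologicalSpace Z]

lemma homotopicRel {f : C(ι × S, Y)} (A : ConeAttachment f X) (F G : C(X, Z)) (T : Set Y)
    (a : C(Y × unitInterval, Z)) (b : C(((ι × S) × unitInterval) × unitInterval, Z))
    (hab : ∀ p u, b ((p, 0), u) = a (f p, u))
    (hb : ∀ i s s' u, b (((i, s), 1), u) = b (((i, s'), 1), u))
    (ha0 : ∀ y, a (y, 0) = F (A.base y)) (ha1 : ∀ y, a (y, 1) = G (A.base y))
    (hb0 : ∀ p, b (p, 0) = F (A.cone p)) (hb1 : ∀ p, b (p, 1) = G (A.cone p))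
    (hT : ∀ y ∈ T, ∀ u, a (y, u) = F (A.base y)) :
    F.HomotopicRel G (A.base '' T) := by
  obtain ⟨Φ, hΦ1, hΦ2⟩ := A.lift a.curry b.curry
    (fun p => by ext u; exact hab p u) (fun i s s' => by ext u; exact hb i s s' u)
  have h1 : ∀ y u, Φ (A.base y) u = a (y, u) := fun y u => by rw [hΦ1]; rfl
  have h2 : ∀ p u, Φ (A.cone p) u = b (p, u) := fun y u => by rw [hΦ2]; rfl
  refine ⟨⟨⟨⟨fun p => Φ p.2 p.1, by fun_prop⟩, ?_, ?_⟩, ?_⟩⟩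
  · intro x
    rcases A.surj x with ⟨y, rfl⟩ | ⟨p, rfl⟩
    · simp [h1, ha0]
    · simp [h2, hb0]
  · intro x
    rcases A.surj x with ⟨y, rfl⟩ | ⟨p, rfl⟩
    · simp [h1, ha1]
    · simp [h2, hb1]
  · rintro t _ ⟨y, hy, rfl⟩
    simp [h1, hT y hy]

/-- Cone attachments along constant maps are functorial for pointed homotopy equivalences. -/
lemma ptHEquiv_of_base {Y' : Type} [TopologicalSpace Y'] {y : Y} {y' : Y'}
    (A : ConeAttachment (ContinuousMap.const (ι × S) y) X)
    (B : ConeAttachment (ContinuousMap.const (ι × S) y') X') (h : PtHEquiv y y') :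
    PtHEquiv (A.base y) (B.base y') := by
  obtain ⟨f, g, hf, hg, ⟨H1⟩, ⟨H2⟩⟩ := h
  obtain ⟨F, hF1, hF2⟩ := A.lift (B.base.comp f) B.cone
    (fun p => by simp [B.cone_zero, hf]) B.cone_one
  obtain ⟨G, hG1, hG2⟩ := B.lift (A.base.comp g) A.cone
    (fun p => by simp [A.cone_zero, hg]) A.cone_one
  refine ⟨F, G, by simp [hF1, hf], by simp [hG1, hg], ?_, ?_⟩
  · rw [← Set.image_singleton]
    refine A.homotopicRel _ _ _ ⟨fun p => A.base (H1 (p.2, p.1)), by fun_prop⟩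
      ⟨fun p => A.cone p.1, by fun_prop⟩ ?_ ?_ ?_ ?_ ?_ ?_ ?_
    · intro p u
      have := H1.eq_fst u (x := y) rfl
      simp [A.cone_zero, this, hf, hg]
    · intro i s s' u; simp [A.cone_one i s s']
    · intro y; simp [hF1, hG1]
    · intro y; simp
    · intro p; simp [hF2, hG2]
    · intro p; simp
    · intro x hx u
      have := H1.eq_fst u hx
      simp [this, hF1, hG1]
  · rw [← Set.image_singleton]
    refine B.homotopicRel _ _ _ ⟨fun p => B.base (H2 (p.2, p.1)), by fun_prop⟩
      ⟨fun p => B.cone p.1, by fun_prop⟩ ?_ ?_ ?_ ?_ ?_ ?_ ?_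
    · intro p u
      have := H2.eq_fst u (x := y') rfl
      simp [B.cone_zero, this, hf, hg]
    · intro i s s' u; simp [B.cone_one i s s']
    · intro y; simp [hF1, hG1]
    · intro y; simp
    · intro p; simp [hF2, hG2]
    · intro p; simp
    · intro x hx u
      have := H2.eq_fst u hx
      simp [this, hF1, hG1]

/-- The cone coordinates, extended by a homotopy of the attaching map to negative parameters. -/
noncomputable def extCone {f g : C(ι × S, Y)} (A : ConeAttachment f X) (H : f.Homotopy g) :
    C((ι × S) × ℝ, X) where
  toFun p := if p.2 ≤ 0 then A.base (H (Set.projIcc 0 1 zero_le_one (-p.2), p.1))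
    else A.cone (p.1, Set.projIcc 0 1 zero_le_one p.2)
  continuous_toFun := by
    refine Continuous.if_le ?_ ?_ continuous_snd continuous_const ?_
    · have := continuous_projIcc (h := zero_le_one (α := ℝ))
      fun_prop
    · have := continuous_projIcc (h := zero_le_one (α := ℝ))
      fun_prop
    · rintro p hp
      simp [hp, A.cone_zero]

lemma extCone_of_nonpos {f g : C(ι × S, Y)} (A : ConeAttachment f X) (H : f.Homotopy g)
    (p : ι × S) {τ : ℝ} (h : τ ≤ 0) :
    A.extCone H (p, τ) = A.base (H (Set.projIcc 0 1 zero_le_one (-τ), p)) := by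
  simp [extCone, h]

lemma extCone_of_nonneg {f g : C(ι × S, Y)} (A : ConeAttachment f X) (H : f.Homotopy g)
    (p : ι × S) {τ : ℝ} (h : 0 ≤ τ) :
    A.extCone H (p, τ) = A.cone (p, Set.projIcc 0 1 zero_le_one τ) := by
  rcases h.eq_or_lt with rfl | h
  · simp [extCone, A.cone_zero]
  · simp [extCone, h]

lemma extCone_zero {f g : C(ι × S, Y)} (A : ConeAttachment f X) (H : f.Homotopy g) (p : ι × S) :
    A.extCone H (p, 0) = A.base (f p) := by
  simp [extCone_of_nonneg, A.cone_zero]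

lemma extCone_one {f g : C(ι × S, Y)} (A : ConeAttachment f X) (H : f.Homotopy g) (p : ι × S) :
    A.extCone H (p, 1) = A.cone (p, 1) := by
  simp [extCone_of_nonneg]

lemma exists_transfer {f g : C(ι × S, Y)} (A : ConeAttachment f X) (B : ConeAttachment g X')
    (H : f.Homotopy g) : ∃ F : C(X, X'), (∀ y, F (A.base y) = B.base y) ∧
      ∀ p (t : unitInterval), F (A.cone (p, t)) = B.extCone H.symm (p, 2 * (t : ℝ) - 1) := by
  have h0 : ∀ p, B.extCone H.symm (p, 2 * ((0 : unitInterval) : ℝ) - 1) = B.base (f p) := by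
    intro p
    simp [extCone_of_nonpos]
  have h1 : ∀ i s s', B.extCone H.symm ((i, s), 2 * ((1 : unitInterval) : ℝ) - 1)
      = B.extCone H.symm ((i, s'), 2 * ((1 : unitInterval) : ℝ) - 1) := by
    intro i s s'
    have : (2 : ℝ) - 1 = 1 := by norm_num
    simp [this, extCone_one, B.cone_one i s s']
  obtain ⟨F, hF, hF'⟩ := A.lift B.base
    ⟨fun p => B.extCone H.symm (p.1, 2 * (p.2 : ℝ) - 1), by fun_prop⟩ h0 h1
  exact ⟨F, hF, fun p t => hF' (p, t)⟩

lemma transfer_comp {f g : C(ι × S, Y)} (A : ConeAttachment f X) (B : ConeAttachment g X')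
    (H : f.Homotopy g) {F : C(X, X')} {G : C(X', X)} (hF : ∀ y, F (A.base y) = B.base y)
    (hF' : ∀ p (t : unitInterval), F (A.cone (p, t)) = B.extCone H.symm (p, 2 * (t : ℝ) - 1))
    (hG : ∀ y, G (B.base y) = A.base y)
    (hG' : ∀ p (t : unitInterval), G (B.cone (p, t)) = A.extCone H (p, 2 * (t : ℝ) - 1)) :
    (G.comp F).HomotopicRel (ContinuousMap.id X) (A.base '' Set.univ) := by
  refine A.homotopicRel _ _ _ ⟨fun p => A.base p.1, by fun_prop⟩
    ⟨fun p => A.extCone H (p.1.1, (1 - (p.2 : ℝ)) * max (-2 * (p.1.2 : ℝ)) (4 * p.1.2 - 3)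
      + p.2 * p.1.2), by fun_prop⟩ ?_ ?_ ?_ ?_ ?_ ?_ ?_
  · intro p u
    simp [extCone_zero]
  · intro i s s' u
    have : max (-2 : ℝ) (4 - 3) = 1 := by norm_num
    simp [this, extCone_one, A.cone_one i s s']
  · intro y; simp [hF, hG]
  · intro y; simp
  · rintro ⟨p, t⟩
    simp only [ContinuousMap.coe_mk, Set.Icc.coe_zero, sub_zero, one_mul, zero_mul, add_zero,
      ContinuousMap.comp_apply, hF']
    have h0 := t.2.1
    have h1 := t.2.2
    rcases le_total (2 * (t : ℝ) - 1) 0 with h | h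
    · rw [extCone_of_nonpos _ _ _ h, hG, ContinuousMap.Homotopy.symm_apply,
        max_eq_left (by linarith), extCone_of_nonpos _ _ _ (by linarith)]
      congr 3
      rw [Set.projIcc_of_mem zero_le_one (x := -(2 * (t : ℝ) - 1)) ⟨by linarith, by linarith⟩,
        Set.projIcc_of_mem zero_le_one (x := -(-2 * (t : ℝ))) ⟨by linarith, by linarith⟩]
      ext
      simp
    · rw [extCone_of_nonneg _ _ _ h, hG', max_eq_right (by linarith),
        Set.projIcc_of_mem zero_le_one (x := (2 * (t : ℝ) - 1)) ⟨by linarith, by linarith⟩]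
      congr 2
      simp only
      ring
  · rintro ⟨p, t⟩
    simp [extCone_of_nonneg _ _ _ t.2.1]
  · intro y _ u; simp [hF, hG]

/-- Attaching cones along homotopic maps gives homotopy equivalent spaces. -/
lemma ptHEquiv_of_homotopic {f g : C(ι × S, Y)} (A : ConeAttachment f X)
    (B : ConeAttachment g X') (h : f.Homotopic g) (y : Y) :
    PtHEquiv (A.base y) (B.base y) := by
  obtain ⟨H⟩ := h
  obtain ⟨F, hF, hF'⟩ := exists_transfer A B H
  obtain ⟨G, hG, hG'⟩ := exists_transfer B A H.symm
  rw [ContinuousMap.Homotopy.symm_symm] at hG'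
  have mono : ∀ {W : Type} [TopologicalSpace W] {a b : C(W, W)} {s t : Set W}, s ⊆ t →
      a.HomotopicRel b t → a.HomotopicRel b s := by
    rintro W _ a b s t hst ⟨K⟩
    exact ⟨⟨K.toHomotopy, fun u x hx => K.prop u x (hst hx)⟩⟩
  refine ⟨F, G, hF y, hG y, mono ?_ (transfer_comp A B H hF hF' hG hG'),
    mono ?_ (transfer_comp B A H.symm hG ?_ hF hF')⟩
  · simp
  · simp
  · rwa [ContinuousMap.Homotopy.symm_symm]

end ConeAttachment

namespace Wedge

variable {c : ℕ} {X Z : Type} [TopologicalSpace X] [TopologicalSpace Z] {x₀ : X}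

/-- The inclusion of the wedge summands. -/
def inj (c : ℕ) (x₀ : X) : C(Fin c × X, Wedge c X x₀) where
  toFun p := Quot.mk _ (Sum.inr p)
  continuous_toFun := continuous_quot_mk.comp continuous_inr

lemma inj_base (i : Fin c) : inj c x₀ (i, x₀) = wedgePt c X x₀ :=
  (Quot.sound (wedgeRel.glue i)).symm

/-- The map out of a wedge determined by a map on the summands. -/
def desc (z : Z) (g : C(Fin c × X, Z)) (h : ∀ i, g (i, x₀) = z) : C(Wedge c X x₀, Z) where
  toFun := Quot.lift (Sum.elim (fun _ => z) g) (by rintro _ _ ⟨i⟩; simp [h])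
  continuous_toFun := continuous_quot_lift _ (continuous_const.sumElim g.continuous)

@[simp] lemma desc_pt (z : Z) (g : C(Fin c × X, Z)) (h : ∀ i, g (i, x₀) = z) :
    desc z g h (wedgePt c X x₀) = z := rfl

@[simp] lemma desc_inj (z : Z) (g : C(Fin c × X, Z)) (h : ∀ i, g (i, x₀) = z) (p) :
    desc z g h (inj c x₀ p) = g p := rfl

lemma eq_pt_or_inj (w : Wedge c X x₀) : w = wedgePt c X x₀ ∨ ∃ p, w = inj c x₀ p := by
  induction w using Quot.ind with
  | mk a =>
    rcases a with ⟨⟩ | p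
    · exact Or.inl rfl
    · exact Or.inr ⟨p, rfl⟩

end Wedge

namespace Wedge2

variable {X Y Z : Type} [TopologicalSpace X] [TopologicalSpace Y] [TopologicalSpace Z]
  {x₀ : X} {y₀ : Y}

/-- The inclusion of the first summand. -/
def inl (x₀ : X) (y₀ : Y) : C(X, Wedge2 X Y x₀ y₀) where
  toFun p := Quot.mk _ (Sum.inl p)
  continuous_toFun := continuous_quot_mk.comp continuous_inl

/-- The inclusion of the second summand. -/
def inr (x₀ : X) (y₀ : Y) : C(Y, Wedge2 X Y x₀ y₀) where
  toFun p := Quot.mk _ (Sum.inr p)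
  continuous_toFun := continuous_quot_mk.comp continuous_inr

lemma inl_base : inl x₀ y₀ x₀ = inr x₀ y₀ y₀ := Quot.sound wedge2Rel.glue

/-- The map out of a binary wedge determined by maps on the summands. -/
def desc (a : C(X, Z)) (b : C(Y, Z)) (h : a x₀ = b y₀) : C(Wedge2 X Y x₀ y₀, Z) where
  toFun := Quot.lift (Sum.elim a b) (by rintro _ _ ⟨⟩; simpa using h)
  continuous_toFun := continuous_quot_lift _ (a.continuous.sumElim b.continuous)

@[simp] lemma desc_inl (a : C(X, Z)) (b : C(Y, Z)) (h : a x₀ = b y₀) (x) :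
    desc a b h (inl x₀ y₀ x) = a x := rfl

@[simp] lemma desc_inr (a : C(X, Z)) (b : C(Y, Z)) (h : a x₀ = b y₀) (y) :
    desc a b h (inr x₀ y₀ y) = b y := rfl

lemma eq_inl_or_inr (w : Wedge2 X Y x₀ y₀) : (∃ x, w = inl x₀ y₀ x) ∨ ∃ y, w = inr x₀ y₀ y := by
  induction w using Quot.ind with
  | mk a =>
    rcases a with x | y
    · exact Or.inl ⟨x, rfl⟩
    · exact Or.inr ⟨y, rfl⟩

end Wedge2

/-- The wedge of `r` and `s` copies of a space is the wedge of `r + s` copies. -/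
lemma ptHEquiv_wedge2_wedge (r s : ℕ) {X : Type} [TopologicalSpace X] (x₀ : X) :
    PtHEquiv (Wedge2.inr (wedgePt r X x₀) (wedgePt s X x₀) (wedgePt s X x₀))
      (wedgePt (r + s) X x₀) := by
  let L : C(Wedge r X x₀, Wedge (r + s) X x₀) := Wedge.desc (wedgePt _ X x₀)
    ⟨fun p => Wedge.inj (r + s) x₀ (Fin.castAdd s p.1, p.2), by fun_prop⟩
    fun i => Wedge.inj_base _
  let R : C(Wedge s X x₀, Wedge (r + s) X x₀) := Wedge.desc (wedgePt _ X x₀)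
    ⟨fun p => Wedge.inj (r + s) x₀ (Fin.natAdd r p.1, p.2), by fun_prop⟩
    fun i => Wedge.inj_base _
  let F : C(Wedge2 (Wedge r X x₀) (Wedge s X x₀) (wedgePt r X x₀) (wedgePt s X x₀),
    Wedge (r + s) X x₀) := Wedge2.desc L R rfl
  let W := Wedge2 (Wedge r X x₀) (Wedge s X x₀) (wedgePt r X x₀) (wedgePt s X x₀)
  let inclL : C(Wedge r X x₀, W) := Wedge2.inl _ _
  let inclR : C(Wedge s X x₀, W) := Wedge2.inr _ _
  let g : Fin (r + s) → X → W := fun i x =>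
    Fin.addCases (fun i => inclL (Wedge.inj r x₀ (i, x))) (fun i => inclR (Wedge.inj s x₀ (i, x))) i
  have hgl : ∀ i x, g (Fin.castAdd s i) x = inclL (Wedge.inj r x₀ (i, x)) := fun i x => by
    simp [g]
  have hgr : ∀ i x, g (Fin.natAdd r i) x = inclR (Wedge.inj s x₀ (i, x)) := fun i x => by
    simp [g]
  have hg : Continuous fun p : Fin (r + s) × X => g p.1 p.2 := by
    rw [continuous_prod_of_discrete_left]
    intro i
    refine Fin.addCases (fun i => ?_) (fun i => ?_) i
    · simp only [hgl]; fun_prop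
    · simp only [hgr]; fun_prop
  have hpt : inclL (wedgePt r X x₀) = inclR (wedgePt s X x₀) := Wedge2.inl_base
  let G : C(Wedge (r + s) X x₀, W) := Wedge.desc (inclR (wedgePt s X x₀)) ⟨_, hg⟩ (by
    intro i
    refine Fin.addCases (fun i => ?_) (fun i => ?_) i
    · simp only [ContinuousMap.coe_mk, hgl, Wedge.inj_base, hpt]
    · simp only [ContinuousMap.coe_mk, hgr, Wedge.inj_base])
  have hL : ∀ p, G (L (Wedge.inj r x₀ p)) = inclL (Wedge.inj r x₀ p) := fun p => hgl p.1 p.2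
  have hR : ∀ p, G (R (Wedge.inj s x₀ p)) = inclR (Wedge.inj s x₀ p) := fun p => hgr p.1 p.2
  refine ⟨F, G, rfl, rfl, ?_, ?_⟩
  · have : G.comp F = ContinuousMap.id W := by
      ext w
      rcases Wedge2.eq_inl_or_inr w with ⟨x, rfl⟩ | ⟨x, rfl⟩
      · rcases Wedge.eq_pt_or_inj x with rfl | ⟨p, rfl⟩
        · exact hpt.symm
        · exact hL p
      · rcases Wedge.eq_pt_or_inj x with rfl | ⟨p, rfl⟩
        · rfl
        · exact hR p
    rw [this]
    exact ContinuousMap.HomotopicRel.refl _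
  · have : F.comp G = ContinuousMap.id (Wedge (r + s) X x₀) := by
      ext w
      rcases Wedge.eq_pt_or_inj w with rfl | ⟨⟨i, x⟩, rfl⟩
      · rfl
      · change F (g i x) = _
        refine Fin.addCases (fun i => ?_) (fun i => ?_) i
        · rw [hgl]; rfl
        · rw [hgr]; rfl
    rw [this]
    exact ContinuousMap.HomotopicRel.refl _

section Suspension

/-- The coordinates of the suspension parametrization of the `3`-sphere. -/
noncomputable def suspVec (s : EuclideanSpace ℝ (Fin 3)) (t : ℝ) : EuclideanSpace ℝ (Fin 4) :=
  WithLp.toLp 2 ![1 - 2 * t, 2 * √(t * (1 - t)) * s 0, 2 * √(t * (1 - t)) * s 1,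
    2 * √(t * (1 - t)) * s 2]

lemma sphere_sq (s : Sph 2) : s.1 0 ^ 2 + s.1 1 ^ 2 + s.1 2 ^ 2 = 1 := by
  have h := s.2
  rw [mem_sphere_zero_iff_norm, EuclideanSpace.norm_eq, Real.sqrt_eq_one, Fin.sum_univ_three] at h
  simpa using h

lemma sphere_ext {s s' : Sph 2} (h0 : s.1 0 = s'.1 0) (h1 : s.1 1 = s'.1 1)
    (h2 : s.1 2 = s'.1 2) : s = s' := by
  ext i
  fin_cases i
  · exact h0
  · exact h1
  · exact h2

/-- The parametrization of the `3`-sphere as a suspension of the `2`-sphere. -/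
noncomputable def suspParam : C(Sph 2 × unitInterval, Sph 3) where
  toFun p := ⟨suspVec p.1.1 p.2, by
    have h := sphere_sq p.1
    have ht : 0 ≤ (p.2 : ℝ) * (1 - p.2) := mul_nonneg p.2.2.1 (by linarith [p.2.2.2])
    have hs := Real.sq_sqrt ht
    rw [mem_sphere_zero_iff_norm, EuclideanSpace.norm_eq, Real.sqrt_eq_one, Fin.sum_univ_four]
    simp only [suspVec, Real.norm_eq_abs, sq_abs]
    simp only [Matrix.cons_val]
    linear_combination (4 * (p.1.1 0 ^ 2 + p.1.1 1 ^ 2 + p.1.1 2 ^ 2)) * hs +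
      4 * (p.2 : ℝ) * (1 - p.2) * h⟩
  continuous_toFun := by
    refine Continuous.subtype_mk ((PiLp.continuous_toLp 2 _).comp ?_) _
    refine continuous_pi fun i => ?_
    fin_cases i <;> simp <;> fun_prop

lemma suspParam_zero (s : Sph 2) : suspParam (s, 0) = sphBase 3 := by
  ext i
  fin_cases i <;> simp [suspParam, suspVec, sphBase]

lemma suspParam_inj {s s' : Sph 2} {t t' : unitInterval}
    (h : suspParam (s, t) = suspParam (s', t')) : t = t' ∧ (t = 0 ∨ t = 1 ∨ s = s') := by
  have h' : ∀ i, suspVec s.1 t i = suspVec s'.1 t' i := fun i =>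
    congrArg (fun x : Sph 3 => x.1 i) h
  have h0 : 1 - 2 * (t : ℝ) = 1 - 2 * t' := by simpa [suspVec] using h' 0
  have htt : t = t' := by ext; linarith
  subst htt
  refine ⟨rfl, ?_⟩
  by_cases ht0 : t = 0
  · exact Or.inl ht0
  by_cases ht1 : t = 1
  · exact Or.inr (Or.inl ht1)
  refine Or.inr (Or.inr ?_)
  have h0 : (0 : ℝ) < t := unitInterval.pos_iff_ne_zero.mpr ht0
  have h1 : (t : ℝ) < 1 := unitInterval.lt_one_iff_ne_one.mpr ht1
  have hs : 2 * √((t : ℝ) * (1 - t)) ≠ 0 := by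
    have : 0 < √((t : ℝ) * (1 - t)) := Real.sqrt_pos.mpr (mul_pos h0 (by linarith))
    positivity
  refine sphere_ext (mul_left_cancel₀ hs ?_) (mul_left_cancel₀ hs ?_) (mul_left_cancel₀ hs ?_)
  · simpa [suspVec] using h' 1
  · simpa [suspVec] using h' 2
  · simpa [suspVec] using h' 3

lemma exists_sphere_of_pos (a b c ρ : ℝ) (hρ : 0 < ρ) (h : a ^ 2 + b ^ 2 + c ^ 2 = ρ ^ 2) :
    ∃ s : Sph 2, a = ρ * s.1 0 ∧ b = ρ * s.1 1 ∧ c = ρ * s.1 2 := by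
  refine ⟨⟨WithLp.toLp 2 ![a / ρ, b / ρ, c / ρ], ?_⟩, ?_, ?_, ?_⟩
  · rw [mem_sphere_zero_iff_norm, EuclideanSpace.norm_eq, Real.sqrt_eq_one, Fin.sum_univ_three]
    simp only [Real.norm_eq_abs, sq_abs, Matrix.cons_val]
    field_simp
    exact h
  all_goals simp only [Matrix.cons_val]; field_simp

lemma exists_suspension_coords {x₀ x₁ x₂ x₃ : ℝ} (hx : x₀ ^ 2 + x₁ ^ 2 + x₂ ^ 2 + x₃ ^ 2 = 1) :
    ∃ (s : Sph 2) (t : unitInterval), x₀ = 1 - 2 * t ∧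
      x₁ = 2 * √((t : ℝ) * (1 - t)) * s.1 0 ∧ x₂ = 2 * √((t : ℝ) * (1 - t)) * s.1 1 ∧
      x₃ = 2 * √((t : ℝ) * (1 - t)) * s.1 2 := by
  have hx0 : x₀ ^ 2 ≤ 1 := by nlinarith [sq_nonneg x₁, sq_nonneg x₂, sq_nonneg x₃]
  have hx0' := abs_le.mp ((sq_le_one_iff_abs_le_one x₀).mp hx0)
  let t : unitInterval := ⟨(1 - x₀) / 2, by linarith, by linarith⟩
  have htv : (t : ℝ) = (1 - x₀) / 2 := rfl
  have hρ : (2 * √((t : ℝ) * (1 - t))) ^ 2 = 1 - x₀ ^ 2 := by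
    rw [mul_pow, Real.sq_sqrt (mul_nonneg t.2.1 (by linarith [t.2.2])), htv]; ring
  have h0' : x₀ = 1 - 2 * t := by rw [htv]; ring
  clear_value t
  rcases (Real.sqrt_nonneg ((t : ℝ) * (1 - t))).eq_or_lt with h0 | h0
  · rw [← h0] at hρ
    have h1 : x₁ = 0 := by nlinarith [sq_nonneg x₁, sq_nonneg x₂, sq_nonneg x₃]
    have h2 : x₂ = 0 := by nlinarith [sq_nonneg x₁, sq_nonneg x₂, sq_nonneg x₃]
    have h3 : x₃ = 0 := by nlinarith [sq_nonneg x₁, sq_nonneg x₂, sq_nonneg x₃]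
    refine ⟨sphBase 2, t, h0', ?_, ?_, ?_⟩ <;> rw [← h0] <;> simpa
  · obtain ⟨s, h1, h2, h3⟩ := exists_sphere_of_pos x₁ x₂ x₃ (2 * √((t : ℝ) * (1 - t)))
      (by positivity) (by linarith)
    exact ⟨s, t, h0', h1, h2, h3⟩

lemma sphere_ext_four {x y : Sph 3} (h0 : x.1 0 = y.1 0) (h1 : x.1 1 = y.1 1)
    (h2 : x.1 2 = y.1 2) (h3 : x.1 3 = y.1 3) : x = y := by
  ext i
  fin_cases i
  · exact h0
  · exact h1
  · exact h2
  · exact h3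

lemma suspParam_surjective : Function.Surjective suspParam := by
  intro x
  have hx : x.1 0 ^ 2 + x.1 1 ^ 2 + x.1 2 ^ 2 + x.1 3 ^ 2 = 1 := by
    have h := x.2
    rw [mem_sphere_zero_iff_norm, EuclideanSpace.norm_eq, Real.sqrt_eq_one,
      Fin.sum_univ_four] at h
    simpa using h
  obtain ⟨s, t, h0, h1, h2, h3⟩ := exists_suspension_coords hx
  exact ⟨(s, t), sphere_ext_four h0.symm h1.symm h2.symm h3.symm⟩

lemma isQuotientMap_suspParam (r : ℕ) :
    Topology.IsQuotientMap fun p : (Fin r × Sph 2) × unitInterval =>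
      (p.1.1, suspParam (p.1.2, p.2)) := by
  have hc : Continuous fun p : (Fin r × Sph 2) × unitInterval =>
      (p.1.1, suspParam (p.1.2, p.2)) := by fun_prop
  refine hc.isClosedMap.isQuotientMap hc ?_
  rintro ⟨i, x⟩
  obtain ⟨⟨s, t⟩, rfl⟩ := suspParam_surjective x
  exact ⟨((i, s), t), rfl⟩

end Suspension

/-- Wedging with `r` copies of the `3`-sphere is attaching `r` cones over the `2`-sphere along
constant maps. -/
noncomputable def wedge2ConeAttachment (r : ℕ) {Y : Type} [TopologicalSpace Y] (y : Y) :
    ConeAttachment (ContinuousMap.const (Fin r × Sph 2) y)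
      (Wedge2 (WedgeSph 3 r) Y (wedgeSphPt 3 r) y) where
  base := Wedge2.inr _ _
  cone := (Wedge2.inl _ _).comp ((Wedge.inj r (sphBase 3)).comp
    ⟨fun p => (p.1.1, suspParam (p.1.2, p.2)), by fun_prop⟩)
  cone_zero p := by
    simp only [ContinuousMap.comp_apply, ContinuousMap.coe_mk, suspParam_zero, Wedge.inj_base,
      ContinuousMap.const_apply]
    exact Wedge2.inl_base
  cone_one i s s' := by
    have : suspParam (s, 1) = suspParam (s', 1) := by
      ext i
      fin_cases i <;> simp [suspParam, suspVec]
    simp [this]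
  surj x := by
    rcases Wedge2.eq_inl_or_inr x with ⟨x, rfl⟩ | ⟨y, rfl⟩
    · rcases Wedge.eq_pt_or_inj x with rfl | ⟨⟨i, x⟩, rfl⟩
      · exact Or.inl ⟨y, Wedge2.inl_base.symm⟩
      · obtain ⟨⟨s, t⟩, rfl⟩ := suspParam_surjective x
        exact Or.inr ⟨((i, s), t), rfl⟩
    · exact Or.inl ⟨y, rfl⟩
  lift {Z} _ a b h0 h1 := by
    have hq := isQuotientMap_suspParam r
    have hlift : ∀ p q : (Fin r × Sph 2) × unitInterval,
        (p.1.1, suspParam (p.1.2, p.2)) = (q.1.1, suspParam (q.1.2, q.2)) → b p = b q := by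
      rintro ⟨⟨i, s⟩, t⟩ ⟨⟨i', s'⟩, t'⟩ h
      simp only [Prod.mk.injEq] at h
      obtain ⟨rfl, h⟩ := h
      obtain ⟨rfl, rfl | rfl | rfl⟩ := suspParam_inj h
      · rw [h0, h0]; rfl
      · exact h1 _ _ _
      · rfl
    let g : C(Fin r × Sph 3, Z) := hq.lift
      (f := ⟨_, hq.continuous⟩) b hlift
    have hg : ∀ i s t, g (i, suspParam (s, t)) = b ((i, s), t) := fun i s t =>
      DFunLike.congr_fun (hq.lift_comp (f := ⟨_, hq.continuous⟩) b hlift) ((i, s), t)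
    have hgb : ∀ i, g (i, sphBase 3) = a y := by
      intro i
      rw [← suspParam_zero (sphBase 2), hg, h0]
      rfl
    refine ⟨Wedge2.desc (Wedge.desc (a y) g hgb) a rfl, fun y => rfl, ?_⟩
    rintro ⟨⟨i, s⟩, t⟩
    exact hg i s t

namespace AbsSC

variable {V : Type} {K L : AbsSC V}

/-- The barycentric coordinates of a point of the realization. -/
def space.wt (f : K.space) : V → ℝ := Subtype.val f

/-- A point of the realization, given by its barycentric coordinates. -/
def space.mk (g : V → ℝ)
    (h : (∀ v, 0 ≤ g v) ∧ ∃ s ∈ K.faces, (∀ v, g v ≠ 0 → v ∈ s) ∧ ∑ v ∈ s, g v = 1) : K.space :=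
  ⟨g, h⟩

@[simp] lemma space.wt_mk (g : V → ℝ)
    (h : (∀ v, 0 ≤ g v) ∧ ∃ s ∈ K.faces, (∀ v, g v ≠ 0 → v ∈ s) ∧ ∑ v ∈ s, g v = 1) :
    (space.mk g h).wt = g := rfl

@[simp] lemma wt_incl (h : L.faces ⊆ K.faces) (f : L.space) : (incl h f).wt = f.wt := rfl

lemma continuous_wt : Continuous fun f : K.space => f.wt := continuous_subtype_val

lemma continuous_mk {X : Type} [TopologicalSpace X] {g : X → V → ℝ} (hg : Continuous g)
    (h : ∀ x, (∀ v, 0 ≤ g x v) ∧ ∃ s ∈ K.faces, (∀ v, g x v ≠ 0 → v ∈ s) ∧ ∑ v ∈ s, g x v = 1) :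
    Continuous fun x => (space.mk (g x) (h x) : K.space) :=
  Continuous.subtype_mk hg h

lemma space_ext {f g : K.space} (h : f.wt = g.wt) : f = g := Subtype.ext h

instance : T2Space K.space := by unfold space; infer_instance

lemma space.wt_nonneg (f : K.space) (v : V) : 0 ≤ f.wt v := f.2.1 v

lemma exists_support (f : K.space) :
    ∃ s ∈ K.faces, (∀ v, v ∈ s ↔ f.wt v ≠ 0) ∧ ∑ v ∈ s, f.wt v = 1 := by
  classical
  obtain ⟨s, hs, h1, h2⟩ : ∃ s ∈ K.faces, (∀ v, f.wt v ≠ 0 → v ∈ s) ∧ ∑ v ∈ s, f.wt v = 1 := f.2.2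
  have hsum : ∑ v ∈ s with f.wt v ≠ 0, f.wt v = 1 := by rw [Finset.sum_filter_ne_zero, h2]
  refine ⟨s.filter fun v => f.wt v ≠ 0, K.down_closed s hs _ (Finset.filter_subset _ _) ?_,
    fun v => ?_, hsum⟩
  · intro h
    rw [h] at hsum
    simp at hsum
  · simpa using h1 v

lemma exists_lift (f : K.space) (h : ∀ s ∈ K.faces, (∀ v, v ∈ s ↔ f.wt v ≠ 0) → s ∈ L.faces) :
    (∀ v, 0 ≤ f.wt v) ∧ ∃ s ∈ L.faces, (∀ v, f.wt v ≠ 0 → v ∈ s) ∧ ∑ v ∈ s, f.wt v = 1 := by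
  obtain ⟨s, hs, h1, h2⟩ := exists_support f
  exact ⟨f.wt_nonneg, s, h s hs h1, fun v hv => (h1 v).2 hv, h2⟩

lemma incl_injective (h : L.faces ⊆ K.faces) : Function.Injective (incl h) := fun _ _ hfg =>
  space_ext (congrArg (fun x : K.space => x.wt) hfg)

section Compact

lemma le_one (f : K.space) (v : V) : f.wt v ≤ 1 := by
  obtain ⟨s, hs, h1, h2⟩ : ∃ s ∈ K.faces, (∀ v, f.wt v ≠ 0 → v ∈ s) ∧ ∑ v ∈ s, f.wt v = 1 := f.2.2
  by_cases hv : f.wt v = 0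
  · rw [hv]; exact zero_le_one
  · rw [← h2]
    exact Finset.single_le_sum (f := f.wt) (fun u _ => f.wt_nonneg u) (h1 v hv)

lemma compactSpace (hK : K.faces.Finite) : CompactSpace K.space := by
  have hc : IsCompact {f : V → ℝ | (∀ v, 0 ≤ f v) ∧
      ∃ s ∈ K.faces, (∀ v, f v ≠ 0 → v ∈ s) ∧ ∑ v ∈ s, f v = 1} := by
    have hcl : IsClosed {f : V → ℝ | (∀ v, 0 ≤ f v) ∧
        ∃ s ∈ K.faces, (∀ v, f v ≠ 0 → v ∈ s) ∧ ∑ v ∈ s, f v = 1} := by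
      have : {f : V → ℝ | (∀ v, 0 ≤ f v) ∧
          ∃ s ∈ K.faces, (∀ v, f v ≠ 0 → v ∈ s) ∧ ∑ v ∈ s, f v = 1} =
          (⋂ v, {f | 0 ≤ f v}) ∩ ⋃ s ∈ K.faces,
            ((⋂ v, ⋂ (_ : v ∉ s), {f | f v = 0}) ∩ {f | ∑ v ∈ s, f v = 1}) := by
        ext f
        simp only [Set.mem_ofPred_eq, Set.mem_inter_iff, Set.mem_iInter, Set.mem_iUnion, exists_prop]
        refine and_congr_right fun _ => exists_congr fun s => and_congr_right fun _ =>
          and_congr_left fun _ => forall_congr' fun v => ?_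
        rw [not_imp_comm]
      rw [this]
      refine (isClosed_iInter fun v => isClosed_le continuous_const (continuous_apply v)).inter ?_
      refine hK.isClosed_biUnion fun s _ => IsClosed.inter ?_ ?_
      · exact isClosed_iInter fun v => isClosed_iInter fun _ =>
          isClosed_eq (continuous_apply v) continuous_const
      · exact isClosed_eq (by fun_prop) continuous_const
    refine (isCompact_univ_pi fun _ : V => isCompact_Icc (a := (0 : ℝ)) (b := 1)).of_isClosed_subset
      hcl ?_
    intro f hf v _
    exact ⟨hf.1 v, le_one (space.mk f hf : K.space) v⟩
  exact isCompact_iff_compactSpace.mp hc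

end Compact

section PushWeights

variable [DecidableEq V]

/-- The weights on `V` obtained by placing the weight `c k` at the vertex `x k`. -/
def pushWeights {κ : Type} [Fintype κ] (x : κ → V) (c : κ → ℝ) : V → ℝ :=
  fun v => ∑ k, if x k = v then c k else 0

lemma pushWeights_apply_of_injective {κ : Type} [Fintype κ] {x : κ → V}
    (hx : Function.Injective x) (c : κ → ℝ) (k : κ) : pushWeights x c (x k) = c k := by
  classical
  simp [pushWeights, hx.eq_iff]

lemma pushWeights_apply_of_notMem {κ : Type} [Fintype κ] {x : κ → V} (c : κ → ℝ) {v : V}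
    (hv : ∀ k, x k ≠ v) : pushWeights x c v = 0 := by
  simp [pushWeights, hv]

lemma pushWeights_sumElim {κ κ' : Type} [Fintype κ] [Fintype κ'] (x : κ → V) (x' : κ' → V)
    (c : κ ⊕ κ' → ℝ) (v : V) : pushWeights (Sum.elim x x') c v =
      pushWeights x (fun k => c (Sum.inl k)) v + pushWeights x' (fun k => c (Sum.inr k)) v :=
  Fintype.sum_sum_type _

lemma continuous_pushWeights {κ : Type} [Fintype κ] (x : κ → V) :
    Continuous (pushWeights x) := by
  refine continuous_pi fun v => continuous_finsetSum _ fun k _ => ?_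
  split_ifs <;> fun_prop

lemma pushWeights_mem {κ : Type} [Fintype κ] {x : κ → V} {c : κ → ℝ} (hc : ∀ k, 0 ≤ c k)
    (hsum : ∑ k, c k = 1) {s : Finset V} (hs : s ∈ K.faces) (hcs : ∀ k, c k ≠ 0 → x k ∈ s) :
    (∀ v, 0 ≤ pushWeights x c v) ∧ ∃ s ∈ K.faces, (∀ v, pushWeights x c v ≠ 0 → v ∈ s) ∧
      ∑ v ∈ s, pushWeights x c v = 1 := by
  refine ⟨fun v => Finset.sum_nonneg fun k _ => ?_, s, hs, fun v hv => ?_, ?_⟩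
  · split_ifs
    exacts [hc k, le_rfl]
  · obtain ⟨k, -, hk⟩ := Finset.exists_ne_zero_of_sum_ne_zero hv
    by_cases hkv : x k = v
    · rw [if_pos hkv] at hk
      exact hkv ▸ hcs k hk
    · exact absurd (if_neg hkv) hk
  · unfold pushWeights
    rw [Finset.sum_comm, ← hsum]
    refine Finset.sum_congr rfl fun k _ => ?_
    rw [Finset.sum_ite_eq]
    by_cases hk : c k = 0
    · simp [hk]
    · rw [if_pos (hcs k hk)]

/-- The vertex `v` as a point of the realization. -/
def pt (K : AbsSC V) (v : V) (hv : {v} ∈ K.faces) : K.space :=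
  space.mk (pushWeights (fun _ : Unit => v) 1)
    (pushWeights_mem (by simp) (by simp) hv (by simp))

lemma joined_of_face {s : Finset V} (hs : s ∈ K.faces) {f g : K.space}
    (hf : ∀ v, f.wt v ≠ 0 → v ∈ s) (hg : ∀ v, g.wt v ≠ 0 → v ∈ s) : Joined f g := by
  have hsum : ∀ f : K.space, (∀ v, f.wt v ≠ 0 → v ∈ s) → ∑ v ∈ s, f.wt v = 1 := by
    intro f hf
    obtain ⟨t, ht, h1, h2⟩ := exists_support f
    rw [← h2]
    refine (Finset.sum_subset (fun v hv => hf v ((h1 v).1 hv)) fun v _ hv => ?_).symm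
    by_contra h
    exact hv ((h1 v).2 h)
  refine ⟨⟨⟨fun t : unitInterval => space.mk
    (fun v => (1 - t : ℝ) * f.wt v + t * g.wt v) ⟨?_, s, hs, ?_, ?_⟩,
    continuous_mk (by fun_prop) _⟩, ?_, ?_⟩⟩
  · intro v
    have := f.wt_nonneg v
    have := g.wt_nonneg v
    have := t.2.1
    have : 0 ≤ 1 - (t : ℝ) := by linarith [t.2.2]
    positivity
  · intro v hv
    by_contra h
    have h1 : f.wt v = 0 := not_not.mp fun h' => h (hf v h')
    have h2 : g.wt v = 0 := not_not.mp fun h' => h (hg v h')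
    simp [h1, h2] at hv
  · rw [Finset.sum_add_distrib, ← Finset.mul_sum, ← Finset.mul_sum, hsum f hf, hsum g hg]
    ring
  · exact space_ext (by ext v; simp)
  · exact space_ext (by ext v; simp)

lemma pt_ne_zero {v u : V} {hv : {v} ∈ K.faces} (h : (pt K v hv).wt u ≠ 0) : u = v := by
  by_contra hu
  exact h (pushWeights_apply_of_notMem (1 : Unit → ℝ) fun _ => Ne.symm hu)

lemma joined_pt_of_edge {v w : V} (h : {v, w} ∈ K.faces) (hv : {v} ∈ K.faces)
    (hw : {w} ∈ K.faces) : Joined (K.pt v hv) (K.pt w hw) :=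
  joined_of_face h (fun u hu => by simp [pt_ne_zero hu]) fun u hu => by simp [pt_ne_zero hu]

end PushWeights

section Collapse

variable [DecidableEq V]

/-- Push the weight common to all the vertices of `p` to the vertex `v`, with speed `τ`. -/
noncomputable def pushTo (p : Finset V) (hp : p.Nonempty) (v : V) (τ : ℝ) (f : V → ℝ) : V → ℝ :=
  fun u => f u + τ * p.inf' hp f * ((if u = v then (p.card : ℝ) else 0) - if u ∈ p then 1 else 0)

lemma continuous_pushTo {p : Finset V} (hp : p.Nonempty) (v : V) :
    Continuous fun x : ℝ × (V → ℝ) => pushTo p hp v x.1 x.2 := by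
  have : Continuous fun f : V → ℝ => p.inf' hp f :=
    Continuous.finset_inf'_apply hp fun u _ => continuous_apply u
  unfold pushTo
  fun_prop

lemma pushTo_mem {p : Finset V} (hp : p.Nonempty) {v : V} (hvp : v ∉ p)
    (h : ∀ s ∈ K.faces, p ⊆ s → insert v s ∈ K.faces) (f : K.space) {τ : ℝ} (h0 : 0 ≤ τ)
    (h1 : τ ≤ 1) :
    (∀ u, 0 ≤ pushTo p hp v τ f.wt u) ∧ ∃ s ∈ K.faces, (∀ u, pushTo p hp v τ f.wt u ≠ 0 → u ∈ s) ∧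
      ∑ u ∈ s, pushTo p hp v τ f.wt u = 1 := by
  obtain ⟨s, hs, hfs, hsum⟩ := exists_support f
  have ht : 0 ≤ p.inf' hp f.wt := (Finset.le_inf'_iff hp _).2 fun u _ => f.wt_nonneg u
  refine ⟨fun u => ?_, ?_⟩
  · unfold pushTo
    have hfu := f.wt_nonneg u
    have hτ := mul_nonneg h0 ht
    by_cases hu : u ∈ p
    · have := Finset.inf'_le f.wt hu
      have huv : u ≠ v := fun h => hvp (h ▸ hu)
      rw [if_pos hu, if_neg huv]
      nlinarith
    · rw [if_neg hu, sub_zero]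
      split_ifs <;> positivity
  · rcases ht.eq_or_lt with ht | ht
    · refine ⟨s, hs, ?_, ?_⟩ <;> simp only [pushTo, ← ht, mul_zero, zero_mul, add_zero]
      · exact fun u hu => (hfs u).2 hu
      · exact hsum
    · have hps : p ⊆ s := fun u hu => (hfs u).2 (ht.trans_le (Finset.inf'_le f.wt hu)).ne'
      refine ⟨insert v s, h s hs hps, fun u hu => ?_, ?_⟩
      · by_contra hus
        rw [Finset.mem_insert, not_or] at hus
        have hfu : f.wt u = 0 := not_not.mp fun h => hus.2 ((hfs u).2 h)
        refine hu ?_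
        have hup : u ∉ p := fun h => hus.2 (hps h)
        simp [pushTo, hfu, hus.1, hup]
      · have hf : ∑ u ∈ insert v s, f.wt u = 1 := by
          rw [← hsum]
          refine (Finset.sum_subset (Finset.subset_insert _ _) fun u _ hu => ?_).symm
          exact not_not.mp fun h => hu ((hfs u).2 h)
        unfold pushTo
        rw [Finset.sum_add_distrib, ← Finset.mul_sum, hf, Finset.sum_sub_distrib,
          Finset.sum_ite_eq', if_pos (Finset.mem_insert_self _ _), Finset.sum_ite_mem,
          Finset.inter_eq_right.2 (hps.trans (Finset.subset_insert _ _))]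
        simp

lemma exists_pushTo_one_eq_zero {p : Finset V} (hp : p.Nonempty) {v : V} (hvp : v ∉ p)
    (f : V → ℝ) : ∃ u ∈ p, pushTo p hp v 1 f u = 0 := by
  obtain ⟨u, hu, h⟩ := Finset.exists_mem_eq_inf' hp f
  refine ⟨u, hu, ?_⟩
  have huv : u ≠ v := fun h => hvp (h ▸ hu)
  simp [pushTo, hu, huv, h]

lemma pushTo_eq_self {p : Finset V} (hp : p.Nonempty) (v : V) (f : L.space)
    (hL : ∀ s ∈ L.faces, ¬ p ⊆ s) (τ : ℝ) : pushTo p hp v τ f.wt = f.wt := by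
  obtain ⟨s, hs, hfs, -⟩ := exists_support f
  have ht : 0 ≤ p.inf' hp f.wt := (Finset.le_inf'_iff hp _).2 fun u _ => f.wt_nonneg u
  rcases ht.eq_or_lt with ht | ht
  · ext u
    simp [pushTo, ← ht]
  · exact absurd (fun u hu => (hfs u).2 (ht.trans_le (Finset.inf'_le f.wt hu)).ne') (hL s hs)

/-- If `v ∉ p` can be added to every face containing `p`, then the faces containing `p` can be
removed from the complex without changing the homotopy type. -/
lemma ptHEquiv_incl_of_remove {p : Finset V} (hp : p.Nonempty) {v : V} (hvp : v ∉ p)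
    (h : ∀ s ∈ K.faces, p ⊆ s → insert v s ∈ K.faces)
    (hL : ∀ s, s ∈ L.faces ↔ s ∈ K.faces ∧ ¬ p ⊆ s) (hLK : L.faces ⊆ K.faces) (x : L.space) :
    PtHEquiv x (incl hLK x) := by
  have hid : ∀ f : L.space, ∀ τ, pushTo p hp v τ f.wt = f.wt := fun f =>
    pushTo_eq_self hp v f fun s hs => ((hL s).1 hs).2
  have hmem : ∀ f : K.space, (∀ u, 0 ≤ pushTo p hp v 1 f.wt u) ∧ ∃ s ∈ L.faces,
      (∀ u, pushTo p hp v 1 f.wt u ≠ 0 → u ∈ s) ∧ ∑ u ∈ s, pushTo p hp v 1 f.wt u = 1 := by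
    intro f
    refine exists_lift (space.mk _ (pushTo_mem hp hvp h f zero_le_one le_rfl) : K.space) fun s hs h' => ?_
    refine (hL s).2 ⟨hs, fun hps => ?_⟩
    obtain ⟨u, hu, hu0⟩ := exists_pushTo_one_eq_zero hp hvp f.wt
    exact (h' u).1 (hps hu) hu0
  let r : C(K.space, L.space) := ⟨fun f => space.mk _ (hmem f), continuous_mk
    ((continuous_pushTo hp v).comp (continuous_const.prodMk continuous_wt)) _⟩
  have hr : r.comp (incl hLK) = ContinuousMap.id _ := by
    ext1 f
    exact space_ext (hid f 1)
  refine ⟨incl hLK, r, rfl, DFunLike.congr_fun hr x, hr ▸ ContinuousMap.HomotopicRel.refl _,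
    ⟨⟨⟨⟨fun q => space.mk _ (pushTo_mem hp hvp h q.2 (τ := 1 - (q.1 : ℝ))
      (by linarith [q.1.2.2]) (by linarith [q.1.2.1])), ?_⟩, ?_, ?_⟩, ?_⟩⟩⟩
  · refine continuous_mk ((continuous_pushTo hp v).comp (Continuous.prodMk ?_ ?_)) _
    · fun_prop
    · exact continuous_wt.comp continuous_snd
  · intro f
    refine space_ext ?_
    simp [r]
  · intro f
    refine space_ext ?_
    ext u
    simp [pushTo]
  · rintro τ f rfl
    refine space_ext ?_
    have h1 := hid x (1 - τ)
    have h2 := hid x 1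
    exact h1.trans h2.symm

lemma ptHEquiv_incl_of_remove_finset (P : Finset (Finset V)) (hP : ∀ p ∈ P, p.Nonempty)
    (h : ∀ p ∈ P, ∃ v, (∀ p' ∈ P, v ∉ p') ∧ ∀ s ∈ K.faces, p ⊆ s → insert v s ∈ K.faces)
    (hL : ∀ s, s ∈ L.faces ↔ s ∈ K.faces ∧ ∀ p ∈ P, ¬ p ⊆ s) (hLK : L.faces ⊆ K.faces)
    (x : L.space) : PtHEquiv x (incl hLK x) := by
  induction P using Finset.induction_on generalizing L with
  | empty =>
    obtain rfl : L = K := by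
      have : L.faces = K.faces := by ext s; simp [hL]
      cases L; cases K; congr
    exact PtHEquiv.of_homeomorph (Homeomorph.refl _) x
  | insert p P hpP ih =>
    let M : AbsSC V :=
      { faces := {s | s ∈ K.faces ∧ ∀ p ∈ P, ¬ p ⊆ s}
        not_empty_mem := fun h => K.not_empty_mem h.1
        down_closed := fun s hs t hts ht =>
          ⟨K.down_closed s hs.1 t hts ht, fun p hp hpt => hs.2 p hp (hpt.trans hts)⟩ }
    have hLM : L.faces ⊆ M.faces := fun s hs =>
      ⟨hLK hs, fun p hp => ((hL s).1 hs).2 p (Finset.mem_insert_of_mem hp)⟩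
    have hMK : M.faces ⊆ K.faces := fun s hs => hs.1
    obtain ⟨v, hv, hvK⟩ := h p (Finset.mem_insert_self _ _)
    have h1 : PtHEquiv x (incl hLM x) := by
      refine ptHEquiv_incl_of_remove (hP p (Finset.mem_insert_self _ _))
        (hv p (Finset.mem_insert_self _ _)) ?_ ?_ hLM x
      · intro s hs hps
        refine ⟨hvK s hs.1 hps, fun p' hp' hs' => hs.2 p' hp' ?_⟩
        exact (Finset.subset_insert_iff_of_notMem (hv p' (Finset.mem_insert_of_mem hp'))).1 hs'
      · intro s
        rw [hL]
        simp only [Finset.mem_insert, forall_eq_or_imp, M, Set.mem_ofPred_eq]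
        tauto
    refine h1.trans (ih (fun p hp => hP p (Finset.mem_insert_of_mem hp)) ?_ (fun s => Iff.rfl) hMK
      (incl hLM x))
    intro p hp
    obtain ⟨v, hv, hvK⟩ := h p (Finset.mem_insert_of_mem hp)
    exact ⟨v, fun p' hp' => hv p' (Finset.mem_insert_of_mem hp'), hvK⟩

end Collapse

end AbsSC

section Tetrahedron

/-- The direction in the hyperplane `∑ x k = 0` of `ℝ⁴` corresponding to a point of the
`2`-sphere. -/
noncomputable def tetVec (s : Sph 2) : Fin 4 → ℝ :=
  ![s.1 0, s.1 1, s.1 2, -s.1 0 - s.1 1 - s.1 2]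

/-- The largest coordinate of `-tetVec s`. -/
noncomputable def tetDepth (s : Sph 2) : ℝ := univ.sup' univ_nonempty fun k => -tetVec s k

lemma sum_tetVec (s : Sph 2) : ∑ k, tetVec s k = 0 := by
  simp [Fin.sum_univ_four, tetVec]

lemma continuous_tetVec : Continuous tetVec := by
  refine continuous_pi fun k => ?_
  fin_cases k <;> simp [tetVec] <;> fun_prop

lemma continuous_tetDepth : Continuous tetDepth :=
  Continuous.finset_sup'_apply _ fun k _ => ((continuous_apply k).comp continuous_tetVec).neg

lemma neg_tetVec_le (s : Sph 2) (k : Fin 4) : -tetVec s k ≤ tetDepth s :=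
  Finset.le_sup' (fun k => -tetVec s k) (mem_univ k)

lemma exists_neg_tetVec_eq (s : Sph 2) : ∃ k, -tetVec s k = tetDepth s := by
  obtain ⟨k, -, hk⟩ := Finset.exists_mem_eq_sup' univ_nonempty fun k => -tetVec s k
  exact ⟨k, hk.symm⟩

lemma tetDepth_pos (s : Sph 2) : 0 < tetDepth s := by
  by_contra! h
  have h0 : ∀ k, 0 ≤ tetVec s k := fun k => by linarith [neg_tetVec_le s k]
  have hz := (Finset.sum_eq_zero_iff_of_nonneg fun k _ => h0 k).1 (sum_tetVec s)
  have hs := sphere_sq s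
  have e0 : s.1 0 = 0 := hz 0 (mem_univ _)
  have e1 : s.1 1 = 0 := hz 1 (mem_univ _)
  have e2 : s.1 2 = 0 := hz 2 (mem_univ _)
  rw [e0, e1, e2] at hs
  norm_num at hs

/-- The parametrization of the `3`-simplex as the cone over its boundary sphere. -/
noncomputable def tetra (p : Sph 2 × unitInterval) : Fin 4 → ℝ := fun k =>
  1 / 4 + (1 - (p.2 : ℝ)) * (tetVec p.1 k / (4 * tetDepth p.1))

lemma continuous_tetra : Continuous tetra := by
  refine continuous_pi fun k => continuous_const.add (Continuous.mul (by fun_prop) ?_)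
  refine Continuous.div ((continuous_apply k).comp (continuous_tetVec.comp continuous_fst))
    ((continuous_const).mul (continuous_tetDepth.comp continuous_fst)) fun p => ?_
  have := tetDepth_pos p.1
  positivity

lemma sum_tetra (p : Sph 2 × unitInterval) : ∑ k, tetra p k = 1 := by
  simp [tetra, Finset.sum_add_distrib, ← Finset.mul_sum, ← Finset.sum_div, sum_tetVec]

lemma le_tetra (p : Sph 2 × unitInterval) (k : Fin 4) : (p.2 : ℝ) / 4 ≤ tetra p k := by
  have hd := tetDepth_pos p.1
  have h : -(1 / 4) ≤ tetVec p.1 k / (4 * tetDepth p.1) := by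
    rw [le_div_iff₀ (by positivity)]
    linarith [neg_tetVec_le p.1 k]
  have ht : 0 ≤ 1 - (p.2 : ℝ) := by linarith [p.2.2.2]
  unfold tetra
  nlinarith

lemma tetra_nonneg (p : Sph 2 × unitInterval) (k : Fin 4) : 0 ≤ tetra p k :=
  le_trans (by linarith [p.2.2.1]) (le_tetra p k)

lemma exists_tetra_eq (p : Sph 2 × unitInterval) : ∃ k, tetra p k = (p.2 : ℝ) / 4 := by
  obtain ⟨k, hk⟩ := exists_neg_tetVec_eq p.1
  have hd := tetDepth_pos p.1
  refine ⟨k, ?_⟩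
  have : tetVec p.1 k = -tetDepth p.1 := by linarith
  unfold tetra
  rw [this]
  field_simp
  ring

lemma tetra_one (s : Sph 2) : tetra (s, 1) = fun _ => 1 / 4 := by
  ext k
  simp [tetra]

lemma tetra_inj {s s' : Sph 2} {t t' : unitInterval} (h : tetra (s, t) = tetra (s', t')) :
    t = t' ∧ (t = 1 ∨ s = s') := by
  have htt : t = t' := by
    obtain ⟨k, hk⟩ := exists_tetra_eq (s, t)
    obtain ⟨k', hk'⟩ := exists_tetra_eq (s', t')
    have h1 := le_tetra (s', t') k
    have h2 := le_tetra (s, t) k'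
    rw [← h, hk] at h1
    rw [h, hk'] at h2
    exact Subtype.ext (by linarith)
  subst htt
  refine ⟨rfl, ?_⟩
  by_cases ht : t = 1
  · exact Or.inl ht
  right
  have ht' : (1 - (t : ℝ)) ≠ 0 := fun h => ht (Subtype.ext (by linarith [h] : (t : ℝ) = 1))
  have hd := tetDepth_pos s
  have hd' := tetDepth_pos s'
  set c := tetDepth s / tetDepth s' with hc
  have hcpos : 0 < c := by positivity
  have hk : ∀ k, tetVec s k = c * tetVec s' k := by
    intro k
    have h1 := congrFun h k
    simp only [tetra, add_right_inj] at h1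
    have h2 := mul_left_cancel₀ ht' h1
    rw [hc]
    field_simp at h2 ⊢
    linarith
  have e0 : s.1 0 = c * s'.1 0 := hk 0
  have e1 : s.1 1 = c * s'.1 1 := hk 1
  have e2 : s.1 2 = c * s'.1 2 := hk 2
  have hs := sphere_sq s
  have hs' := sphere_sq s'
  have hc1 : c = 1 := by
    have : c ^ 2 = 1 := by
      rw [e0, e1, e2] at hs
      linear_combination hs - c ^ 2 * hs'
    nlinarith
  rw [hc1, one_mul] at e0 e1 e2
  exact sphere_ext e0 e1 e2

lemma exists_tetra {c : Fin 4 → ℝ} (hc : ∀ k, 0 ≤ c k) (hsum : ∑ k, c k = 1) :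
    ∃ p, tetra p = c := by
  by_cases hb : c = fun _ => 1 / 4
  · exact ⟨(sphBase 2, 1), by rw [tetra_one, hb]⟩
  rw [Fin.sum_univ_four] at hsum
  set ρ := √((c 0 - 1 / 4) ^ 2 + (c 1 - 1 / 4) ^ 2 + (c 2 - 1 / 4) ^ 2) with hρ
  have hρ2 : ρ ^ 2 = (c 0 - 1 / 4) ^ 2 + (c 1 - 1 / 4) ^ 2 + (c 2 - 1 / 4) ^ 2 :=
    Real.sq_sqrt (by positivity)
  have hρpos : 0 < ρ := by
    refine (Real.sqrt_nonneg _).lt_of_ne fun h0 => hb ?_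
    rw [← hρ] at h0
    rw [← h0] at hρ2
    have e0 : c 0 - 1 / 4 = 0 := by nlinarith [sq_nonneg (c 0 - 1 / 4), sq_nonneg (c 1 - 1 / 4), sq_nonneg (c 2 - 1 / 4)]
    have e1 : c 1 - 1 / 4 = 0 := by nlinarith [sq_nonneg (c 0 - 1 / 4), sq_nonneg (c 1 - 1 / 4), sq_nonneg (c 2 - 1 / 4)]
    have e2 : c 2 - 1 / 4 = 0 := by nlinarith [sq_nonneg (c 0 - 1 / 4), sq_nonneg (c 1 - 1 / 4), sq_nonneg (c 2 - 1 / 4)]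
    ext k
    fin_cases k <;> simp <;> linarith
  obtain ⟨s, h0, h1, h2⟩ := exists_sphere_of_pos _ _ _ ρ hρpos hρ2.symm
  have hk : ∀ k, c k = 1 / 4 + ρ * tetVec s k := by
    intro k
    fin_cases k
    · simp [tetVec]; linarith
    · simp [tetVec]; linarith
    · simp [tetVec]; linarith
    · simp [tetVec]; linarith
  have hd := tetDepth_pos s
  obtain ⟨k, hkd⟩ := exists_neg_tetVec_eq s
  have hck := hc k
  rw [hk, ← neg_neg (tetVec s k), hkd] at hck
  refine ⟨(s, ⟨1 - 4 * (ρ * tetDepth s), by linarith, by nlinarith [mul_pos hρpos hd]⟩), ?_⟩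
  ext k
  rw [hk]
  simp only [tetra]
  field_simp
  ring

end Tetrahedron

lemma continuous_uncurry_of_discrete {ι X Z : Type} [TopologicalSpace ι] [DiscreteTopology ι]
    [TopologicalSpace X] [TopologicalSpace Z] {F : ι → X → Z} (h : ∀ i, Continuous (F i)) :
    Continuous fun p : ι × X => F p.1 p.2 :=
  continuous_prod_of_discrete_left.mpr h

namespace AbsSC

variable {V : Type} {K K₀ : AbsSC V} [DecidableEq V]

/-- The simplices of `K` outside of the subcomplex `K₀` are `r` tetrahedra, each of which has an
opposite tetrahedron such that the boundary of their join-like octahedral hull lies in `K₀`. -/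
structure CellData (K₀ K : AbsSC V) (r : ℕ) where
  /-- The vertices of the tetrahedra. -/
  vert : Fin r → Fin 4 → V
  /-- The vertices of the opposite tetrahedra. -/
  opp : Fin r → Fin 4 → V
  vert_injective : ∀ i, Function.Injective (vert i)
  eq_of_image_eq : ∀ i j, univ.image (vert i) = univ.image (vert j) → i = j
  notMem : ∀ i, univ.image (vert i) ∉ K₀.faces
  mem_iff : ∀ s, s ∈ K.faces ↔ s ∈ K₀.faces ∨ ∃ i, s = univ.image (vert i)
  mixed : ∀ i (S : Finset (Fin 4)), S ≠ univ →
    univ.image (fun k => if k ∈ S then vert i k else opp i k) ∈ K₀.faces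

namespace CellData

variable {r : ℕ} (D : CellData K₀ K r)

lemma subset (D : CellData K₀ K r) : K₀.faces ⊆ K.faces := fun s hs =>
  (D.mem_iff s).2 (Or.inl hs)

lemma cone_mem (p : (Fin r × Sph 2) × unitInterval) :
    (∀ v, 0 ≤ pushWeights (D.vert p.1.1) (tetra (p.1.2, p.2)) v) ∧ ∃ s ∈ K.faces,
      (∀ v, pushWeights (D.vert p.1.1) (tetra (p.1.2, p.2)) v ≠ 0 → v ∈ s) ∧
      ∑ v ∈ s, pushWeights (D.vert p.1.1) (tetra (p.1.2, p.2)) v = 1 :=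
  pushWeights_mem (tetra_nonneg _) (sum_tetra _) ((D.mem_iff _).2 (Or.inr ⟨p.1.1, rfl⟩))
    fun k _ => by simp

/-- The parametrization of the tetrahedra. -/
noncomputable def cone : C((Fin r × Sph 2) × unitInterval, K.space) where
  toFun p := space.mk _ (D.cone_mem p)
  continuous_toFun := by
    refine continuous_mk ?_ _
    have := continuous_uncurry_of_discrete (F := fun (i : Fin r) (q : Sph 2 × unitInterval) =>
      pushWeights (D.vert i) (tetra q)) fun i =>
        (continuous_pushWeights (D.vert i)).comp continuous_tetra
    exact this.comp (f := fun p : (Fin r × Sph 2) × unitInterval => (p.1.1, (p.1.2, p.2)))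
      (by fun_prop)

@[simp] lemma wt_cone (p : (Fin r × Sph 2) × unitInterval) (k : Fin 4) :
    (D.cone p).wt (D.vert p.1.1 k) = tetra (p.1.2, p.2) k :=
  pushWeights_apply_of_injective (D.vert_injective _) _ k

lemma exists_of_wt_cone_ne_zero {p : (Fin r × Sph 2) × unitInterval} {v : V}
    (h : (D.cone p).wt v ≠ 0) : ∃ k, D.vert p.1.1 k = v := by
  by_contra! h'
  exact h (pushWeights_apply_of_notMem _ h')

lemma wt_cone_pos {p : (Fin r × Sph 2) × unitInterval} (hp : p.2 ≠ 0) (k : Fin 4) :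
    (D.cone p).wt (D.vert p.1.1 k) ≠ 0 := by
  rw [wt_cone]
  have := le_tetra (p.1.2, p.2) k
  have : (0 : ℝ) < p.2 := unitInterval.pos_iff_ne_zero.mpr hp
  dsimp only at *
  linarith

lemma mem_image_iff {p : (Fin r × Sph 2) × unitInterval} (hp : p.2 ≠ 0) (v : V) :
    v ∈ univ.image (D.vert p.1.1) ↔ (D.cone p).wt v ≠ 0 := by
  rw [Finset.mem_image]
  constructor
  · rintro ⟨k, -, rfl⟩
    exact D.wt_cone_pos hp k
  · intro h
    obtain ⟨k, hk⟩ := D.exists_of_wt_cone_ne_zero h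
    exact ⟨k, mem_univ _, hk⟩

/-- The weights on the octahedral hull of a tetrahedron and its opposite, interpolating between
the weights `c` on the tetrahedron and the barycenter of its opposite. -/
noncomputable def hullWeights (c : Fin 4 → ℝ) (u : ℝ) : Fin 4 ⊕ Fin 4 → ℝ :=
  Sum.elim (fun k => max ((1 - u) * c k - u / 4) 0 / ∑ j, |(1 - u) * c j - u / 4|)
    fun k => max (-((1 - u) * c k - u / 4)) 0 / ∑ j, |(1 - u) * c j - u / 4|

lemma hull_denom_pos {c : Fin 4 → ℝ} {u : ℝ} (hu : 0 ≤ u) (hc : ∃ k, c k = 0)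
    (hsum : ∑ k, c k = 1) : 0 < ∑ j, |(1 - u) * c j - u / 4| := by
  refine (Finset.sum_nonneg fun j _ => abs_nonneg _).lt_of_ne fun h => ?_
  have hz := (Finset.sum_eq_zero_iff_of_nonneg fun j _ => abs_nonneg _).1 h.symm
  obtain ⟨k, hk⟩ := hc
  have h1 := abs_eq_zero.1 (hz k (mem_univ k))
  have hu0 : u = 0 := by rw [hk] at h1; linarith
  have : ∑ k, c k = 0 := Finset.sum_eq_zero fun j _ => by
    have := abs_eq_zero.1 (hz j (mem_univ j))
    rw [hu0] at this
    linarith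
  linarith

lemma hullWeights_mem {c : Fin 4 → ℝ} {u : ℝ} (hu : 0 ≤ u)
    (hc : ∃ k, c k = 0) (hsum : ∑ k, c k = 1) (i : Fin r) :
    (∀ v, 0 ≤ pushWeights (Sum.elim (D.vert i) (D.opp i)) (hullWeights c u) v) ∧
      ∃ s ∈ K₀.faces,
      (∀ v, pushWeights (Sum.elim (D.vert i) (D.opp i)) (hullWeights c u) v ≠ 0 → v ∈ s) ∧
      ∑ v ∈ s, pushWeights (Sum.elim (D.vert i) (D.opp i)) (hullWeights c u) v = 1 := by
  have hpos := hull_denom_pos hu hc hsum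
  refine pushWeights_mem ?_ ?_ (D.mixed i (univ.filter fun k => 0 < (1 - u) * c k - u / 4) ?_) ?_
  · rintro (k | k)
    · exact div_nonneg (le_max_right _ _) hpos.le
    · exact div_nonneg (le_max_right _ _) hpos.le
  · simp only [hullWeights, Fintype.sum_sum_type, Sum.elim_inl, Sum.elim_inr]
    have habs : ∀ a b : ℝ, max a 0 / b + max (-a) 0 / b = |a| / b := fun a b => by
      rw [← add_div]
      congr 1
      rcases le_total 0 a with h | h
      · rw [max_eq_left h, max_eq_right (by linarith), abs_of_nonneg h, add_zero]
      · rw [max_eq_right h, max_eq_left (by linarith), abs_of_nonpos h, zero_add]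
    rw [← Finset.sum_add_distrib, Finset.sum_congr rfl fun k _ => habs _ _, ← Finset.sum_div,
      div_self hpos.ne']
  · obtain ⟨k, hk⟩ := hc
    intro h
    have := Finset.mem_filter.1 (h ▸ mem_univ k : k ∈ univ.filter _)
    rw [hk] at this
    linarith [this.2]
  · rintro (k | k) hk
    · refine Finset.mem_image.2 ⟨k, mem_univ _, if_pos ?_⟩
      rw [Finset.mem_filter]
      refine ⟨mem_univ _, ?_⟩
      by_contra! h
      simp [hullWeights, max_eq_right h] at hk
    · refine Finset.mem_image.2 ⟨k, mem_univ _, if_neg ?_⟩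
      rw [Finset.mem_filter]
      rintro ⟨-, h⟩
      refine hk ?_
      simp only [hullWeights, Sum.elim_inr]
      rw [max_eq_right (by linarith), zero_div]

lemma exists_tetra_zero (s : Sph 2) : ∃ k, tetra (s, 0) k = 0 := by
  obtain ⟨k, hk⟩ := exists_tetra_eq (s, 0)
  exact ⟨k, by simpa using hk⟩

/-- The contraction of the boundary of the tetrahedra. -/
noncomputable def contraction : C(Fin r × (Sph 2 × unitInterval), K₀.space) where
  toFun p := space.mk _ (D.hullWeights_mem p.2.2.2.1
    (exists_tetra_zero p.2.1) (sum_tetra _) p.1)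
  continuous_toFun := by
    refine continuous_mk ?_ _
    refine continuous_uncurry_of_discrete (F := fun (i : Fin r) (q : Sph 2 × unitInterval) =>
      pushWeights (Sum.elim (D.vert i) (D.opp i)) (hullWeights (tetra (q.1, 0)) q.2)) fun i => ?_
    refine (continuous_pushWeights _).comp ?_
    have hk : ∀ k, Continuous fun q : Sph 2 × unitInterval => tetra (q.1, 0) k := fun k =>
      (continuous_apply k).comp (continuous_tetra.comp (by fun_prop))
    have hden : Continuous fun q : Sph 2 × unitInterval =>
        ∑ j, |(1 - (q.2 : ℝ)) * tetra (q.1, 0) j - q.2 / 4| :=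
      continuous_finsetSum _ fun j _ => by have := hk j; fun_prop
    have hne : ∀ q : Sph 2 × unitInterval,
        ∑ j, |(1 - (q.2 : ℝ)) * tetra (q.1, 0) j - q.2 / 4| ≠ 0 := fun q =>
      (hull_denom_pos q.2.2.1 (exists_tetra_zero q.1) (sum_tetra _)).ne'
    refine continuous_pi ?_
    rintro (k | k)
    · refine Continuous.div ?_ hden hne
      have := hk k
      fun_prop
    · refine Continuous.div ?_ hden hne
      have := hk k
      fun_prop

/-- The attaching map of the tetrahedra. -/
noncomputable def bdry : C(Fin r × Sph 2, K₀.space) :=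
  D.contraction.comp ⟨fun p => (p.1, (p.2, 0)), by fun_prop⟩

lemma wt_bdry (p : Fin r × Sph 2) : (D.bdry p).wt = (D.cone (p, 0)).wt := by
  change pushWeights (Sum.elim (D.vert p.1) (D.opp p.1))
    (hullWeights (tetra (p.2, 0)) ((0 : unitInterval) : ℝ)) =
      pushWeights (D.vert p.1) (tetra (p.2, 0))
  have hs : ∑ j, |tetra (p.2, 0) j| = 1 := by
    rw [← sum_tetra (p.2, 0)]
    exact Finset.sum_congr rfl fun j _ => abs_of_nonneg (tetra_nonneg _ j)
  have : hullWeights (tetra (p.2, 0)) ((0 : unitInterval) : ℝ) =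
      Sum.elim (tetra (p.2, 0)) fun _ => 0 := by
    ext (k | k)
    · simp [hullWeights, hs, tetra_nonneg]
    · simp [hullWeights, hs, tetra_nonneg]
  rw [this]
  ext v
  rw [pushWeights_sumElim]
  simp [pushWeights]

lemma incl_bdry (p : Fin r × Sph 2) : incl D.subset (D.bdry p) = D.cone (p, 0) :=
  space_ext (D.wt_bdry p)

lemma contraction_one (i : Fin r) (s s' : Sph 2) :
    D.contraction (i, (s, 1)) = D.contraction (i, (s', 1)) := by
  refine space_ext ?_
  simp [contraction, hullWeights]

lemma bdry_homotopic (o : K₀.space) (hj : ∀ v (hv : {v} ∈ K₀.faces), Joined (K₀.pt v hv) o) :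
    D.bdry.Homotopic (ContinuousMap.const _ o) := by
  have hw : ∀ i, {D.opp i 0} ∈ K₀.faces := fun i =>
    K₀.down_closed _ (D.mixed i ∅ (Finset.univ_nonempty.ne_empty).symm) _
      (by simp) (by simp)
  let y : Fin r → K₀.space := fun i => D.contraction (i, (sphBase 2, 1))
  have hy : ∀ i, Joined (y i) o := by
    intro i
    refine Joined.trans ?_ (hj _ (hw i))
    refine joined_of_face (s := univ.image (D.opp i)) ?_ ?_ ?_
    · have := D.mixed i ∅ (Finset.univ_nonempty.ne_empty).symm
      simpa using this
    · intro v hv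
      by_contra h
      refine hv ?_
      simp only [Finset.mem_image, Finset.mem_univ, true_and, not_exists] at h
      change pushWeights (Sum.elim (D.vert i) (D.opp i)) _ v = 0
      rw [pushWeights_sumElim]
      simp [pushWeights, hullWeights, h]
    · intro v hv
      rw [pt_ne_zero hv]
      simp
  let γ : ∀ i, Path (y i) o := fun i => (hy i).somePath
  have h1 : D.bdry.Homotopic ⟨fun p => y p.1, (continuous_of_discreteTopology (f := y)).comp continuous_fst⟩ := by
    refine ⟨⟨⟨fun q => D.contraction (q.2.1, (q.2.2, q.1)), by fun_prop⟩, ?_, ?_⟩⟩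
    · intro p; rfl
    · intro p
      exact D.contraction_one _ _ _
  refine h1.trans ⟨⟨⟨fun q => γ q.2.1 q.1, ?_⟩, ?_, ?_⟩⟩
  · exact (continuous_uncurry_of_discrete (F := fun i t => γ i t) fun i => (γ i).continuous).comp
      (f := fun q : unitInterval × (Fin r × Sph 2) => (q.2.1, q.1)) (by fun_prop)
  · intro p
    simp
  · intro p
    simp

lemma eq_bdry_of_incl_eq_cone {f : K₀.space} {p : (Fin r × Sph 2) × unitInterval}
    (h : incl D.subset f = D.cone p) : p.2 = 0 ∧ f = D.bdry p.1 := by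
  have hp : p.2 = 0 := by
    by_contra hp
    obtain ⟨s, hs, h1, -⟩ := exists_support f
    refine D.notMem p.1.1 ?_
    convert hs using 1
    ext v
    rw [D.mem_image_iff hp, ← h, wt_incl, h1]
  refine ⟨hp, incl_injective D.subset ?_⟩
  rw [h, incl_bdry, ← hp]

lemma eq_of_cone_eq_cone {p q : (Fin r × Sph 2) × unitInterval} (hp : p.2 ≠ 0) (hq : q.2 ≠ 0)
    (h : D.cone p = D.cone q) : p.1.1 = q.1.1 ∧ p.2 = q.2 ∧ (p.2 = 1 ∨ p.1.2 = q.1.2) := by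
  obtain ⟨⟨i, s⟩, t⟩ := p
  obtain ⟨⟨j, s'⟩, t'⟩ := q
  obtain rfl : i = j := by
    refine D.eq_of_image_eq _ _ ?_
    ext v
    exact (D.mem_image_iff hp v).trans (by rw [h]; exact (D.mem_image_iff hq v).symm)
  refine ⟨rfl, tetra_inj ?_⟩
  ext k
  rw [← D.wt_cone ((i, s), t), h]
  exact D.wt_cone ((i, s'), t') k

lemma cone_surj (f : K.space) : (∃ g, incl D.subset g = f) ∨ ∃ p, D.cone p = f := by
  obtain ⟨s, hs, h1, h2⟩ := exists_support f
  rcases (D.mem_iff s).1 hs with hs | ⟨i, rfl⟩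
  · exact Or.inl ⟨space.mk f.wt ⟨f.wt_nonneg, s, hs, fun v hv => (h1 v).2 hv, h2⟩, rfl⟩
  · right
    rw [Finset.sum_image (D.vert_injective i).injOn] at h2
    obtain ⟨p, hp⟩ := exists_tetra (fun k => f.wt_nonneg (D.vert i k)) h2
    refine ⟨((i, p.1), p.2), space_ext ?_⟩
    ext v
    by_cases hv : ∃ k, D.vert i k = v
    · obtain ⟨k, rfl⟩ := hv
      rw [D.wt_cone ((i, p.1), p.2)]
      exact congrFun hp k
    · have e1 : f.wt v = 0 := by
        by_contra h
        obtain ⟨k, -, hk⟩ := Finset.mem_image.1 ((h1 v).2 h)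
        exact hv ⟨k, hk⟩
      rw [e1]
      by_contra h
      exact hv (D.exists_of_wt_cone_ne_zero h)

/-- Adding the tetrahedra to `K₀` attaches cones over the `2`-sphere. -/
noncomputable def coneAttachment (hfin : K₀.faces.Finite) : ConeAttachment D.bdry K.space where
  base := incl D.subset
  cone := D.cone
  cone_zero p := (D.incl_bdry p).symm
  cone_one i s s' := by
    refine space_ext ?_
    simp [cone, tetra_one]
  surj := D.cone_surj
  lift {Z} _ a b h0 h1 := by
    have := compactSpace hfin
    let q : C(K₀.space ⊕ ((Fin r × Sph 2) × unitInterval), K.space) :=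
      ⟨Sum.elim (incl D.subset) D.cone, by fun_prop⟩
    have hq : Topology.IsQuotientMap q := by
      refine q.continuous.isClosedMap.isQuotientMap q.continuous fun f => ?_
      rcases D.cone_surj f with ⟨g, hg⟩ | ⟨p, hp⟩
      exacts [⟨Sum.inl g, hg⟩, ⟨Sum.inr p, hp⟩]
    let ab : C(K₀.space ⊕ ((Fin r × Sph 2) × unitInterval), Z) :=
      ⟨Sum.elim a b, by fun_prop⟩
    have hb : ∀ f p, incl D.subset f = D.cone p → a f = b p := by
      rintro f ⟨p, t⟩ h
      obtain ⟨rfl, rfl⟩ := D.eq_bdry_of_incl_eq_cone h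
      exact (h0 p).symm
    have hfac : ∀ y z, q y = q z → ab y = ab z := by
      rintro (f | p) (g | p') h
      · exact congrArg a (incl_injective D.subset h)
      · exact hb f p' h
      · exact (hb g p h.symm).symm
      · change b p = b p'
        have h : D.cone p = D.cone p' := h
        by_cases hp : p.2 = 0
        · have e : incl D.subset (D.bdry p.1) = D.cone p := by rw [D.incl_bdry, ← hp]
          rw [← hb _ p e, hb _ p' (e.trans h)]
        by_cases hp' : p'.2 = 0
        · have e : incl D.subset (D.bdry p'.1) = D.cone p' := by rw [D.incl_bdry, ← hp']
          rw [← hb _ p' e, hb _ p (e.trans h.symm)]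
        obtain ⟨⟨i, s⟩, t⟩ := p
        obtain ⟨⟨j, s'⟩, t'⟩ := p'
        obtain ⟨e1, e2, e3⟩ := D.eq_of_cone_eq_cone hp hp' h
        dsimp only at e1 e2 e3
        subst e1 e2
        rcases e3 with rfl | rfl
        · exact h1 _ _ _
        · rfl
    have hF := hq.lift_comp ab hfac
    exact ⟨hq.lift ab hfac, fun y => DFunLike.congr_fun hF (Sum.inl y),
      fun p => DFunLike.congr_fun hF (Sum.inr p)⟩

/-- If `K` is obtained from `K₀` by adding `r` tetrahedra with opposites, and `L ≃ K₀`, then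
`K` is a wedge of `L` and `r` copies of the `3`-sphere. -/
lemma ptHEquiv_wedge2 (D : CellData K₀ K r) (hfin : K₀.faces.Finite) (o : K₀.space)
    (hj : ∀ v (hv : {v} ∈ K₀.faces), Joined (K₀.pt v hv) o) {Y : Type} [TopologicalSpace Y] (y : Y)
    (h : PtHEquiv o y) :
    PtHEquiv (incl D.subset o) (Wedge2.inr (wedgeSphPt 3 r) y y) :=
  ((D.coneAttachment hfin).ptHEquiv_of_homotopic (wedge2ConeAttachment r o)
    (D.bdry_homotopic o hj) o).trans
    ((wedge2ConeAttachment r o).ptHEquiv_of_base (wedge2ConeAttachment r y) h)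

end CellData

end AbsSC

section Order

/-- The key by which `precLT` compares finite sets. -/
def precKey (A : Finset ℕ) : ℕ ×ₗ List ℕ := toLex (A.card, A.sort (· ≤ ·))

lemma precLT_iff {A B : Finset ℕ} : precLT A B ↔ precKey A < precKey B := by
  rw [precKey, precKey, Prod.Lex.lt_iff]
  rfl

lemma precKey_injective : Function.Injective precKey := fun A B h => by
  have h2 : A.sort (· ≤ ·) = B.sort (· ≤ ·) := congrArg (fun x => (ofLex x).2) h
  rw [← Finset.sort_toFinset (r := (· ≤ ·)) A, h2, Finset.sort_toFinset]

lemma precLE_iff {A B : Finset ℕ} : precLE A B ↔ precKey A ≤ precKey B := by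
  rw [precLE, precLT_iff, le_iff_lt_or_eq, precKey_injective.eq_iff]

lemma precLT_irrefl (A : Finset ℕ) : ¬ precLT A A := by
  rw [precLT_iff]
  exact lt_irrefl _

lemma precLT.trans {A B C : Finset ℕ} (h : precLT A B) (h' : precLT B C) : precLT A C := by
  rw [precLT_iff] at *
  exact lt_trans h h'

lemma precLT_of_card_lt {A B : Finset ℕ} (h : A.card < B.card) : precLT A B := Or.inl h

lemma card_le_of_precLE {A B : Finset ℕ} (h : precLE A B) : A.card ≤ B.card := by
  rcases h with (h | h) | rfl
  exacts [h.le, h.1.le, le_rfl]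

lemma lex_sort_of_lt {s t : Finset ℕ} {b : ℕ} (hs : ∀ x ∈ s, b < x) (ht : t.Nonempty)
    (htb : ∀ x ∈ t, b < x) :
    List.Lex (· < ·) ((insert b s).sort (· ≤ ·)) (t.sort (· ≤ ·)) := by
  rw [Finset.sort_insert _ (fun x hx => (hs x hx).le) fun h => (hs b h).false]
  cases h : t.sort (· ≤ ·) with
  | nil =>
    obtain ⟨x, hx⟩ := ht
    have := (Finset.mem_sort (· ≤ ·)).2 hx
    simp [h] at this
  | cons y l =>
    exact List.Lex.rel (htb y ((Finset.mem_sort (· ≤ ·)).1 (by simp [h])))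

lemma lex_sort_insert {C : Finset ℕ} {a b : ℕ} (ha : a ∉ C) (hb : b ∉ C) (hba : b < a) :
    List.Lex (· < ·) ((insert b C).sort (· ≤ ·)) ((insert a C).sort (· ≤ ·)) := by
  induction C using Finset.induction_on_min with
  | empty => exact lex_sort_of_lt (by simp) (by simp) (by simpa)
  | insert c C hc ih =>
    rw [Finset.mem_insert, not_or] at ha hb
    rcases lt_or_gt_of_ne hb.1 with h | h
    · refine lex_sort_of_lt ?_ (by simp) ?_
      · intro x hx
        rcases Finset.mem_insert.1 hx with rfl | hx
        exacts [h, h.trans (hc x hx)]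
      · intro x hx
        rcases Finset.mem_insert.1 hx with rfl | hx
        · exact hba
        rcases Finset.mem_insert.1 hx with rfl | hx
        exacts [h, h.trans (hc x hx)]
    · have key : ∀ d, c < d → d ∉ C →
          (insert d (insert c C)).sort (· ≤ ·) = c :: (insert d C).sort (· ≤ ·) := by
        intro d hd hdC
        rw [Finset.insert_comm, Finset.sort_insert]
        · intro x hx
          rcases Finset.mem_insert.1 hx with rfl | hx
          exacts [hd.le, (hc x hx).le]
        · intro h'
          rcases Finset.mem_insert.1 h' with rfl | h'
          exacts [hd.false, (hc c h').false]
      rw [key b h hb.2, key a (h.trans hba) ha.2]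
      exact List.Lex.cons (ih ha.2 hb.2)

end Order

section Toggle

/-- The set obtained from `A` by toggling the membership of the elements of `D`, where toggling
`0` has no effect. -/
def toggle (A D : Finset ℕ) : Finset ℕ := symmDiff A (D.erase 0)

@[simp] lemma toggle_empty (A : Finset ℕ) : toggle A ∅ = A := by simp [toggle]

lemma mem_toggle {A D : Finset ℕ} {x : ℕ} (hx : x ≠ 0) :
    x ∈ toggle A D ↔ (x ∈ A ↔ x ∉ D) := by
  simp only [toggle, Finset.mem_symmDiff, Finset.mem_erase]
  tauto

lemma toggle_subset {A D : Finset ℕ} {m : ℕ} (hA : A ⊆ Icc 1 m) (hD : ∀ x ∈ D, x ≤ m) :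
    toggle A D ⊆ Icc 1 m := by
  intro x hx
  rw [toggle, Finset.mem_symmDiff, Finset.mem_erase] at hx
  rcases hx with hx | hx
  · exact hA hx.1
  · have := hD x hx.1.2
    rw [Finset.mem_Icc]
    omega

lemma symmDiff_toggle_toggle (A D E : Finset ℕ) :
    symmDiff (toggle A D) (toggle A E) = (symmDiff D E).erase 0 := by
  ext x
  simp only [toggle, Finset.mem_symmDiff, Finset.mem_erase]
  tauto

lemma even_card_symmDiff {D E : Finset ℕ} (hD : Even D.card) (hE : Even E.card) :
    Even (symmDiff D E).card := by
  have h : (symmDiff D E).card + 2 * (D ∩ E).card = D.card + E.card := by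
    have h1 := Finset.card_sdiff_add_card_inter D E
    have h2 := Finset.card_sdiff_add_card_inter E D
    have h3 : (symmDiff D E).card = (D \ E).card + (E \ D).card := by
      rw [symmDiff_def, Finset.sup_eq_union, Finset.card_union_of_disjoint disjoint_sdiff_sdiff]
    rw [Finset.inter_comm] at h2
    omega
  rw [Nat.even_iff] at *
  omega

lemma card_symmDiff_toggle_le_two {A D E : Finset ℕ} (hD : Even D.card) (hE : Even E.card) :
    (symmDiff (toggle A D) (toggle A E)).card ≤ 2 ↔ (symmDiff D E).card ≤ 2 := by
  rw [symmDiff_toggle_toggle]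
  have h1 := Finset.pred_card_le_card_erase (s := symmDiff D E) (a := 0)
  have h2 := Finset.card_erase_le (s := symmDiff D E) (a := 0)
  have h3 := even_card_symmDiff hD hE
  rw [Nat.even_iff] at h3
  omega

lemma toggle_inj {A D E : Finset ℕ} (hD : Even D.card) (hE : Even E.card)
    (h : toggle A D = toggle A E) : D = E := by
  have h0 : ((symmDiff D E).erase 0).card = 0 := by
    rw [← symmDiff_toggle_toggle A, h]
    simp
  have h1 := Finset.pred_card_le_card_erase (s := symmDiff D E) (a := 0)
  have h3 := even_card_symmDiff hD hE
  rw [Nat.even_iff] at h3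
  have h4 : (symmDiff D E).card = 0 := by omega
  rwa [Finset.card_eq_zero, ← Finset.bot_eq_empty, symmDiff_eq_bot] at h4

lemma even_card_pair {p q : ℕ} (h : p ≠ q) : Even ({p, q} : Finset ℕ).card := by
  rw [Finset.card_pair h]
  exact even_two

lemma card_symmDiff_pair_le_two {a b c d : ℕ} (hab : a ≠ b) (hcd : c ≠ d) :
    (symmDiff ({a, b} : Finset ℕ) {c, d}).card ≤ 2 ↔ a = c ∨ a = d ∨ b = c ∨ b = d := by
  constructor
  · intro h
    by_contra! h'
    have hd : Disjoint ({a, b} : Finset ℕ) {c, d} := by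
      simp
      omega
    rw [hd.symmDiff_eq_sup, Finset.sup_eq_union, Finset.card_union_of_disjoint hd,
      Finset.card_pair hab, Finset.card_pair hcd] at h
    omega
  · have key : ∀ a b d : ℕ, (symmDiff ({a, b} : Finset ℕ) {a, d}).card ≤ 2 := by
      intro a b d
      refine (Finset.card_le_card (t := {b, d}) ?_).trans Finset.card_le_two
      intro x hx
      simp only [Finset.mem_symmDiff, Finset.mem_insert, Finset.mem_singleton] at hx ⊢
      tauto
    rintro (rfl | rfl | rfl | rfl)
    · exact key _ _ _
    · rw [Finset.pair_comm c]; exact key _ _ _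
    · rw [Finset.pair_comm a]; exact key _ _ _
    · rw [Finset.pair_comm a, Finset.pair_comm c]; exact key _ _ _

lemma precLT_toggle {A : Finset ℕ} {p q : ℕ} (hpq : p < q) (hq : q ∈ A) :
    precLT (toggle A {p, q}) A := by
  by_cases hp : p ≠ 0 ∧ p ∉ A
  · have h1 : toggle A {p, q} = insert p (A.erase q) := by
      ext x
      simp only [toggle, Finset.mem_symmDiff, Finset.mem_erase, Finset.mem_insert,
        Finset.mem_singleton]
      by_cases hx : x = q
      · subst hx
        have : x ≠ 0 := by omega
        have : x ≠ p := by omega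
        simp [*]
      · by_cases hx : x = p
        · subst hx
          simp [hp]
        · simp [*]
    have hA : A = insert q (A.erase q) := (Finset.insert_erase hq).symm
    have hpA : p ∉ A.erase q := fun h => hp.2 (Finset.mem_of_mem_erase h)
    rw [h1]
    nth_rewrite 2 [hA]
    right
    refine ⟨?_, lex_sort_insert (Finset.notMem_erase q A) hpA hpq⟩
    rw [Finset.card_insert_of_notMem hpA, Finset.card_insert_of_notMem (Finset.notMem_erase q A)]
  · refine Or.inl ((Finset.card_le_card (t := A.erase q) ?_).trans_lt
      (Finset.card_erase_lt_of_mem hq))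
    intro x hx
    simp only [toggle, Finset.mem_symmDiff, Finset.mem_erase, Finset.mem_insert,
        Finset.mem_singleton] at hx ⊢
    by_cases hx' : x = q
    · subst hx'
      have : x ≠ 0 := by omega
      tauto
    · by_cases hx' : x = p
      · subst hx'
        tauto
      · tauto

lemma exists_eq_toggle {m : ℕ} {A B : Finset ℕ} (hA : A ⊆ Icc 1 m) (hB : B ⊆ Icc 1 m)
    (hBA : precLT B A) (h : (symmDiff A B).card ≤ 2) :
    ∃ p q, p < q ∧ q ∈ A ∧ B = toggle A {p, q} := by
  have h0 : 0 ∉ symmDiff A B := by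
    intro h0
    have h1 : 0 ∉ Icc 1 m := by simp
    rcases Finset.mem_symmDiff.1 h0 with h0 | h0
    exacts [h1 (hA h0.1), h1 (hB h0.1)]
  have hex : ∃ p q, p < q ∧ symmDiff A B = ({p, q} : Finset ℕ).erase 0 := by
    have hne : (symmDiff A B).card ≠ 0 := by
      intro h
      rw [Finset.card_eq_zero, ← Finset.bot_eq_empty, symmDiff_eq_bot] at h
      exact precLT_irrefl _ (h ▸ hBA)
    have : (symmDiff A B).card = 1 ∨ (symmDiff A B).card = 2 := by omega
    rcases this with h | h
    · obtain ⟨q, hq⟩ := Finset.card_eq_one.1 h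
      have hq0 : q ≠ 0 := by
        rintro rfl
        exact h0 (by simp [hq])
      refine ⟨0, q, Nat.pos_of_ne_zero hq0, ?_⟩
      rw [hq]
      ext x
      simp only [Finset.mem_singleton, Finset.mem_erase, Finset.mem_insert]
      grind
    · obtain ⟨p, q, hpq, hD⟩ := Finset.card_eq_two.1 h
      rcases lt_or_gt_of_ne hpq with hlt | hlt
      · exact ⟨p, q, hlt, by rw [Finset.erase_eq_of_notMem (hD ▸ h0), hD]⟩
      · refine ⟨q, p, hlt, ?_⟩
        rw [Finset.pair_comm, Finset.erase_eq_of_notMem (hD ▸ h0), hD]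
  obtain ⟨p, q, hpq, hD⟩ := hex
  have hB' : B = toggle A {p, q} := by rw [toggle, ← hD, symmDiff_symmDiff_cancel_left]
  have hA' : A = toggle B {p, q} := by
    rw [toggle, ← hD, symmDiff_comm A, symmDiff_symmDiff_cancel_left]
  have hq : q ∈ symmDiff A B := by
    rw [hD]
    simp
    omega
  rcases Finset.mem_symmDiff.1 hq with hq | hq
  · exact ⟨p, q, hpq, hq.1, hB'⟩
  · have := precLT_toggle hpq hq.1
    rw [← hA'] at this
    exact absurd (hBA.trans this) (precLT_irrefl _)

lemma mem_of_toggle_precLT {A : Finset ℕ} {p q : ℕ} (hpq : p < q)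
    (h : precLT (toggle A {p, q}) A) : q ∈ A := by
  by_contra hq
  have h1 : q ∈ toggle A {p, q} := by
    rw [mem_toggle (by omega)]
    simp [hq]
  have h2 := precLT_toggle hpq h1
  have h3 : toggle (toggle A {p, q}) {p, q} = A := by simp [toggle]
  rw [h3] at h2
  exact precLT_irrefl _ (h.trans h2)

end Toggle

namespace AbsSC

variable {V : Type} {K : AbsSC V}

/-- The simplices of `K` which do not contain any of the simplices in `P`. -/
def avoid (K : AbsSC V) (P : Finset (Finset V)) : AbsSC V where
  faces := {s | s ∈ K.faces ∧ ∀ p ∈ P, ¬ p ⊆ s}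
  not_empty_mem h := K.not_empty_mem h.1
  down_closed s hs t hts ht :=
    ⟨K.down_closed s hs.1 t hts ht, fun p hp hpt => hs.2 p hp (hpt.trans hts)⟩

lemma avoid_subset (K : AbsSC V) (P : Finset (Finset V)) : (K.avoid P).faces ⊆ K.faces :=
  fun _ hs => hs.1

lemma insert_mem_avoid [DecidableEq V] {P : Finset (Finset V)} {s : Finset V} {v : V}
    (hs : s ∈ (K.avoid P).faces) (hv : ∀ p ∈ P, v ∉ p) (h : insert v s ∈ K.faces) :
    insert v s ∈ (K.avoid P).faces :=
  ⟨h, fun p hp hps => hs.2 p hp ((Finset.subset_insert_iff_of_notMem (hv p hp)).1 hps)⟩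

end AbsSC

section Star

variable {m z : ℕ} {A : Finset ℕ} {s : Finset (Finset ℕ)}

lemma toggle_ne_self {x y : ℕ} (hxy : x ≠ y) : toggle A {x, y} ≠ A := fun h => by
  have := toggle_inj (E := ∅) (even_card_pair hxy) (by simp) (h.trans (toggle_empty A).symm)
  simp at this

lemma toggle_ne_toggle {x y a b : ℕ} (hxy : x ≠ y) (hab : a ≠ b) (ha : a ≠ y) (hb : b ≠ y) :
    toggle A {x, y} ≠ toggle A {a, b} := fun h => by
  have := toggle_inj (even_card_pair hxy) (even_card_pair hab) h
  have : y ∈ ({a, b} : Finset ℕ) := this ▸ (by simp)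
  simp at this
  omega

lemma toggle_mem_FprecLT (hA : A ⊆ Icc 1 m) {x y : ℕ} (hxy : x < y) (hy : y ∈ A) :
    toggle A {x, y} ∈ FprecLT m A := by
  have := Finset.mem_Icc.1 (hA hy)
  exact ⟨toggle_subset hA (by simp; omega), precLT_toggle hxy hy⟩

lemma eq_or_exists_toggle (hA : A ⊆ Icc 1 m) (hs : s ∈ (VRc (FprecLE m A) 2).faces)
    (hAs : A ∈ s) {B : Finset ℕ} (hB : B ∈ s) :
    B = A ∨ ∃ x y, x < y ∧ y ∈ A ∧ B = toggle A {x, y} := by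
  obtain ⟨hB1, hB2 | hB2⟩ := hs.2.1 B hB
  · exact Or.inr (exists_eq_toggle hA hB1 hB2 (hs.2.2 A hAs B hB))
  · exact Or.inl hB2

lemma mem_of_toggle_mem_face (hs : s ∈ (VRc (FprecLE m A) 2).faces) {x y : ℕ} (hxy : x < y)
    (h : toggle A {x, y} ∈ s) : y ∈ A := by
  obtain ⟨-, h | h⟩ := hs.2.1 _ h
  · exact mem_of_toggle_precLT hxy h
  · exact absurd h (toggle_ne_self hxy.ne)

lemma meet_of_mem_face {F : Set (Finset ℕ)} (hs : s ∈ (VRc F 2).faces) {a b c d : ℕ}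
    (hab : a ≠ b) (hcd : c ≠ d) (h : toggle A {a, b} ∈ s) (h' : toggle A {c, d} ∈ s) :
    a = c ∨ a = d ∨ b = c ∨ b = d := by
  rw [← card_symmDiff_pair_le_two hab hcd,
    ← card_symmDiff_toggle_le_two (A := A) (even_card_pair hab) (even_card_pair hcd)]
  exact hs.2.2 _ h _ h'

lemma insert_toggle_mem_faces (hA : A ⊆ Icc 1 m) (hz : z ∈ A)
    (hs : s ∈ (VRc (FprecLE m A) 2).faces) (hAs : A ∈ s) {x : ℕ} (hx : x < z)
    (h : ∀ e f, e < f → toggle A {e, f} ∈ s → e = x ∨ e = z ∨ f = x ∨ f = z) :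
    insert (toggle A {x, z}) s ∈ (VRc (FprecLE m A) 2).faces := by
  have key : ∀ B ∈ s, (symmDiff B (toggle A {x, z})).card ≤ 2 := by
    intro B hB
    rcases eq_or_exists_toggle hA hs hAs hB with rfl | ⟨e, f, hef, hf, rfl⟩
    · nth_rewrite 1 [← toggle_empty B]
      rw [card_symmDiff_toggle_le_two (by simp) (even_card_pair hx.ne)]
      simpa [← Finset.bot_eq_empty] using Finset.card_le_two
    · rw [card_symmDiff_toggle_le_two (even_card_pair hef.ne) (even_card_pair hx.ne),
        card_symmDiff_pair_le_two hef.ne hx.ne]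
      exact h e f hef hB
  refine ⟨Finset.insert_nonempty _ _, fun B hB => ?_, fun B hB C hC => ?_⟩
  · rcases Finset.mem_insert.1 hB with rfl | hB
    · exact ⟨(toggle_mem_FprecLT hA hx hz).1, Or.inl (toggle_mem_FprecLT hA hx hz).2⟩
    · exact hs.2.1 B hB
  · rcases Finset.mem_insert.1 hB with rfl | hB <;> rcases Finset.mem_insert.1 hC with rfl | hC
    · simp
    · rw [symmDiff_comm]; exact key C hC
    · exact key B hB
    · exact hs.2.2 B hB C hC

/-- The triples `p < q < r < z` with `q, r ∈ A`. -/
def triples (A : Finset ℕ) (z : ℕ) : Finset (ℕ × ℕ × ℕ) :=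
  (range z ×ˢ range z ×ˢ range z).filter fun t =>
    t.1 < t.2.1 ∧ t.2.1 < t.2.2 ∧ t.2.1 ∈ A ∧ t.2.2 ∈ A

lemma mem_triples {p q r : ℕ} :
    (p, q, r) ∈ triples A z ↔ p < q ∧ q < r ∧ r < z ∧ q ∈ A ∧ r ∈ A := by
  simp only [triples, Finset.mem_filter, Finset.mem_product, Finset.mem_range]
  constructor
  · tauto
  · rintro ⟨h1, h2, h3, h4⟩
    exact ⟨⟨by omega, by omega, h3⟩, h1, h2, h4⟩

/-- The index sets of the vertices of a tetrahedral cell. -/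
def cellIdx : Fin 4 → Finset (Fin 4) := ![∅, {0, 1}, {0, 2}, {1, 2}]

/-- The vertices of the tetrahedral cell of a triple. -/
def cellVert (A : Finset ℕ) (z : ℕ) (t : ℕ × ℕ × ℕ) (k : Fin 4) : Finset ℕ :=
  toggle A ((cellIdx k).image ![t.1, t.2.1, t.2.2, z])

/-- The vertices opposite to those of the tetrahedral cell of a triple. -/
def cellOpp (A : Finset ℕ) (z : ℕ) (t : ℕ × ℕ × ℕ) (k : Fin 4) : Finset ℕ :=
  toggle A ((cellIdx k)ᶜ.image ![t.1, t.2.1, t.2.2, z])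

/-- The tetrahedral cell of a triple. -/
def cell (A : Finset ℕ) (z : ℕ) (t : ℕ × ℕ × ℕ) : Finset (Finset ℕ) := univ.image (cellVert A z t)

lemma mem_cell {p q r : ℕ} {B : Finset ℕ} : B ∈ cell A z (p, q, r) ↔
    B = A ∨ B = toggle A {p, q} ∨ B = toggle A {p, r} ∨ B = toggle A {q, r} := by
  simp [cell, cellVert, cellIdx, Fin.exists_fin_succ, eq_comm]

lemma injective_cellPts {t : ℕ × ℕ × ℕ} (ht : t ∈ triples A z) :
    Function.Injective ![t.1, t.2.1, t.2.2, z] := by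
  obtain ⟨p, q, r⟩ := t
  rw [mem_triples] at ht
  intro i j hij
  fin_cases i <;> fin_cases j <;> simp at hij ⊢ <;> omega

lemma even_card_image_cellPts {t : ℕ × ℕ × ℕ} (ht : t ∈ triples A z) {D : Finset (Fin 4)}
    (hD : Even D.card) : Even (D.image ![t.1, t.2.1, t.2.2, z]).card := by
  rwa [Finset.card_image_of_injective _ (injective_cellPts ht)]

lemma even_card_cellIdx : ∀ k, Even (cellIdx k).card := by decide

lemma even_card_compl_cellIdx : ∀ k, Even (cellIdx k)ᶜ.card := by decide

lemma cellVert_injective {t : ℕ × ℕ × ℕ} (ht : t ∈ triples A z) :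
    Function.Injective (cellVert A z t) := fun i j hij => by
  have h1 := toggle_inj (even_card_image_cellPts ht (even_card_cellIdx i))
    (even_card_image_cellPts ht (even_card_cellIdx j)) hij
  exact (by decide : ∀ i j, cellIdx i = cellIdx j → i = j) i j
    (Finset.image_injective (injective_cellPts ht) h1)

lemma toggle_notMem_cell {t : ℕ × ℕ × ℕ} (ht : t ∈ triples A z) {x : ℕ} (hx : x < z) :
    toggle A {x, z} ∉ cell A z t := by
  obtain ⟨p, q, r⟩ := t
  rw [mem_triples] at ht
  rw [mem_cell]
  rintro (h | h | h | h)
  · exact toggle_ne_self hx.ne h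
  all_goals exact toggle_ne_toggle hx.ne (by omega) (by omega) (by omega) h

lemma eq_cell_of_subset (hA : A ⊆ Icc 1 m) {t : ℕ × ℕ × ℕ} (ht : t ∈ triples A z)
    (hs : s ∈ (VRc (FprecLE m A) 2).faces) (hts : cell A z t ⊆ s) : s = cell A z t := by
  refine (hts.antisymm fun B hB => ?_).symm
  obtain ⟨p, q, r⟩ := t
  rw [mem_triples] at ht
  have hAs : A ∈ s := hts (mem_cell.2 (by simp))
  have h1 : toggle A {p, q} ∈ s := hts (mem_cell.2 (by simp))
  have h2 : toggle A {p, r} ∈ s := hts (mem_cell.2 (by simp))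
  have h3 : toggle A {q, r} ∈ s := hts (mem_cell.2 (by simp))
  rw [mem_cell]
  rcases eq_or_exists_toggle hA hs hAs hB with rfl | ⟨e, f, hef, hf, rfl⟩
  · simp
  · have k1 := meet_of_mem_face hs hef.ne (by omega) hB h1
    have k2 := meet_of_mem_face hs hef.ne (by omega) hB h2
    have k3 := meet_of_mem_face hs hef.ne (by omega) hB h3
    have : (e = p ∧ f = q) ∨ (e = p ∧ f = r) ∨ (e = q ∧ f = r) := by omega
    rcases this with ⟨rfl, rfl⟩ | ⟨rfl, rfl⟩ | ⟨rfl, rfl⟩ <;> simp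

lemma exists_cell_subset (hs : s ∈ (VRc (FprecLE m A) 2).faces) (hAs : A ∈ s) {p q r : ℕ}
    (hpq : p < q) (hqr : q < r) (hr : r < z) (h1 : toggle A {p, q} ∈ s)
    (h2 : toggle A {p, r} ∈ s) (h3 : toggle A {q, r} ∈ s) :
    ∃ t ∈ triples A z, cell A z t ⊆ s := by
  refine ⟨(p, q, r), mem_triples.2 ⟨hpq, hqr, hr, mem_of_toggle_mem_face hs hpq h1,
    mem_of_toggle_mem_face hs hqr h3⟩, fun B hB => ?_⟩
  rw [mem_cell] at hB
  rcases hB with rfl | rfl | rfl | rfl <;> assumption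

lemma exists_cell_subset_of_ne (hs : s ∈ (VRc (FprecLE m A) 2).faces) (hAs : A ∈ s) {x y w : ℕ}
    (hxy : x ≠ y) (hxw : x ≠ w) (hyw : y ≠ w) (hx : x < z) (hy : y < z) (hw : w < z)
    (h1 : toggle A {x, y} ∈ s) (h2 : toggle A {x, w} ∈ s) (h3 : toggle A {y, w} ∈ s) :
    ∃ t ∈ triples A z, cell A z t ⊆ s := by
  have h1' : toggle A {y, x} ∈ s := by rwa [Finset.pair_comm]
  have h2' : toggle A {w, x} ∈ s := by rwa [Finset.pair_comm]
  have h3' : toggle A {w, y} ∈ s := by rwa [Finset.pair_comm]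
  rcases lt_or_gt_of_ne hxy with h | h <;> rcases lt_or_gt_of_ne hxw with h' | h' <;>
    rcases lt_or_gt_of_ne hyw with h'' | h''
  · exact exists_cell_subset hs hAs h h'' hw h1 h2 h3
  · exact exists_cell_subset hs hAs h' h'' hy h2 h1 h3'
  · omega
  · exact exists_cell_subset hs hAs h' h hy h2' h3' h1
  · exact exists_cell_subset hs hAs h h' hw h1' h3 h2
  · omega
  · exact exists_cell_subset hs hAs h'' h' hx h3 h1' h2'
  · exact exists_cell_subset hs hAs h'' h hx h3' h2' h1'

end Star

section Collapse

variable {m z : ℕ} {A : Finset ℕ}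

/-- The Vietoris–Rips complex of `F_{⪯ A}` with the tetrahedral cells removed. -/
def noCell (m z : ℕ) (A : Finset ℕ) : AbsSC (Finset ℕ) :=
  (VRc (FprecLE m A) 2).avoid ((triples A z).image (cell A z))

/-- The triangles `{A, A + x + y, A + x + w}` with `x, y, w < z`. -/
def cherries (z : ℕ) (A : Finset ℕ) : Finset (Finset (Finset ℕ)) :=
  ((range z ×ˢ range z ×ˢ range z).filter fun t => t.1 ≠ t.2.1 ∧ t.1 ≠ t.2.2 ∧ t.2.1 ≠ t.2.2).image
    fun t => {A, toggle A {t.1, t.2.1}, toggle A {t.1, t.2.2}}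

/-- The edges `{A, A + x + y}` with `x, y < z`. -/
def lowEdges (z : ℕ) (A : Finset ℕ) : Finset (Finset (Finset ℕ)) :=
  ((range z ×ˢ range z).filter fun t => t.1 ≠ t.2).image fun t => {A, toggle A {t.1, t.2}}

lemma mem_cherries {p : Finset (Finset ℕ)} : p ∈ cherries z A ↔ ∃ x y w, x < z ∧ y < z ∧ w < z ∧
    x ≠ y ∧ x ≠ w ∧ y ≠ w ∧ p = {A, toggle A {x, y}, toggle A {x, w}} := by
  simp only [cherries, Finset.mem_image, Finset.mem_filter, Finset.mem_product, Finset.mem_range,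
    Prod.exists]
  grind

lemma mem_lowEdges {p : Finset (Finset ℕ)} : p ∈ lowEdges z A ↔ ∃ x y, x < z ∧ y < z ∧
    x ≠ y ∧ p = {A, toggle A {x, y}} := by
  simp only [lowEdges, Finset.mem_image, Finset.mem_filter, Finset.mem_product, Finset.mem_range,
    Prod.exists]
  grind

lemma toggle_notMem_of_mem_cells {x : ℕ} (hx : x < z) :
    ∀ p ∈ (triples A z).image (cell A z), toggle A {x, z} ∉ p := by
  intro p hp
  obtain ⟨t, ht, rfl⟩ := Finset.mem_image.1 hp
  exact toggle_notMem_cell ht hx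

lemma toggle_notMem_of_mem_cherries {x : ℕ} (hx : x < z) :
    ∀ p ∈ cherries z A, toggle A {x, z} ∉ p := by
  intro p hp
  obtain ⟨a, b, c, ha, hb, hc, hab, hac, -, rfl⟩ := mem_cherries.1 hp
  simp only [Finset.mem_insert, Finset.mem_singleton, not_or]
  exact ⟨toggle_ne_self hx.ne, toggle_ne_toggle hx.ne hab ha.ne hb.ne,
    toggle_ne_toggle hx.ne hac ha.ne hc.ne⟩

lemma toggle_notMem_of_mem_lowEdges {x : ℕ} (hx : x < z) :
    ∀ p ∈ lowEdges z A, toggle A {x, z} ∉ p := by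
  intro p hp
  obtain ⟨a, b, ha, hb, hab, rfl⟩ := mem_lowEdges.1 hp
  simp only [Finset.mem_insert, Finset.mem_singleton, not_or]
  exact ⟨toggle_ne_self hx.ne, toggle_ne_toggle hx.ne hab ha.ne hb.ne⟩

/-- The complex `noCell m z A` with the triangles `cherries z A` removed. -/
def noCherry (m z : ℕ) (A : Finset ℕ) : AbsSC (Finset ℕ) := (noCell m z A).avoid (cherries z A)

/-- The complex `noCherry m z A` with the edges `lowEdges z A` removed. -/
def noLowEdge (m z : ℕ) (A : Finset ℕ) : AbsSC (Finset ℕ) := (noCherry m z A).avoid (lowEdges z A)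

lemma ptHEquiv_noCherry (hA : A ⊆ Icc 1 m) (hz : z ∈ A) (x : (noCherry m z A).space) :
    PtHEquiv x (AbsSC.incl (AbsSC.avoid_subset _ _) x : (noCell m z A).space) := by
  refine AbsSC.ptHEquiv_incl_of_remove_finset (cherries z A) ?_ ?_ (fun s => Iff.rfl) _ x
  · intro p hp
    obtain ⟨a, b, c, -, -, -, -, -, -, rfl⟩ := mem_cherries.1 hp
    simp
  · intro p hp
    obtain ⟨a, b, c, ha, hb, hc, hab, hac, hbc, rfl⟩ := mem_cherries.1 hp
    refine ⟨toggle A {a, z}, toggle_notMem_of_mem_cherries ha, fun s hs hps => ?_⟩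
    have hAs : A ∈ s := hps (by simp)
    have h1 : toggle A {a, b} ∈ s := hps (by simp)
    have h2 : toggle A {a, c} ∈ s := hps (by simp)
    refine AbsSC.insert_mem_avoid hs (toggle_notMem_of_mem_cells ha)
      (insert_toggle_mem_faces hA hz hs.1 hAs ha fun e f hef h => ?_)
    by_contra h'
    have k1 := meet_of_mem_face hs.1 hef.ne hab h h1
    have k2 := meet_of_mem_face hs.1 hef.ne hac h h2
    have h3 : toggle A {b, c} ∈ s := by
      have : (e = b ∧ f = c) ∨ (e = c ∧ f = b) := by omega
      rcases this with ⟨rfl, rfl⟩ | ⟨rfl, rfl⟩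
      · exact h
      · rwa [Finset.pair_comm]
    obtain ⟨t, ht, hts⟩ := exists_cell_subset_of_ne hs.1 hAs hab hac hbc ha hb hc h1 h2 h3
    exact hs.2 _ (Finset.mem_image_of_mem _ ht) hts

lemma ptHEquiv_noLowEdge (hA : A ⊆ Icc 1 m) (hz : z ∈ A) (hmax : ∀ x ∈ A, x ≤ z)
    (x : (noLowEdge m z A).space) :
    PtHEquiv x (AbsSC.incl (AbsSC.avoid_subset _ _) x : (noCherry m z A).space) := by
  refine AbsSC.ptHEquiv_incl_of_remove_finset (lowEdges z A) ?_ ?_ (fun s => Iff.rfl) _ x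
  · intro p hp
    obtain ⟨a, b, -, -, -, rfl⟩ := mem_lowEdges.1 hp
    simp
  · intro p hp
    obtain ⟨a, b, ha, hb, hab, rfl⟩ := mem_lowEdges.1 hp
    refine ⟨toggle A {a, z}, toggle_notMem_of_mem_lowEdges ha, fun s hs hps => ?_⟩
    have hAs : A ∈ s := hps (by simp)
    have h1 : toggle A {a, b} ∈ s := hps (by simp)
    refine AbsSC.insert_mem_avoid hs (toggle_notMem_of_mem_cherries ha)
      (AbsSC.insert_mem_avoid hs.1 (toggle_notMem_of_mem_cells ha)
      (insert_toggle_mem_faces hA hz hs.1.1 hAs ha fun e f hef h => ?_))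
    by_contra h'
    have hf := hmax f (mem_of_toggle_mem_face hs.1.1 hef h)
    have k1 := meet_of_mem_face hs.1.1 hef.ne hab h h1
    have key : ∀ c, c < z → c ≠ a → c ≠ b → toggle A {b, c} ∉ s := by
      intro c hc hca hcb hcs
      refine hs.2 _ (mem_cherries.2 ⟨b, a, c, hb, ha, hc, hab.symm, hcb.symm, hca.symm, rfl⟩) ?_
      rw [Finset.pair_comm b a]
      intro B hB
      simp only [Finset.mem_insert, Finset.mem_singleton] at hB
      rcases hB with rfl | rfl | rfl <;> assumption
    have : e = b ∨ f = b := by omega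
    rcases this with rfl | rfl
    · exact key f (by omega) (by omega) (by omega) h
    · exact key e (by omega) (by omega) (by omega) (by rwa [Finset.pair_comm])

lemma subset_noLowEdge : (VRc (FprecLT m A) 2).faces ⊆ (noLowEdge m z A).faces := by
  intro s hs
  have hAs : A ∉ s := fun h => precLT_irrefl A (hs.2.1 A h).2
  refine ⟨⟨⟨⟨hs.1, fun B hB => ⟨(hs.2.1 B hB).1, Or.inl (hs.2.1 B hB).2⟩, hs.2.2⟩, ?_⟩, ?_⟩, ?_⟩
  · intro p hp hps
    obtain ⟨⟨a, b, c⟩, -, rfl⟩ := Finset.mem_image.1 hp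
    exact hAs (hps (mem_cell.2 (by simp)))
  · intro p hp hps
    obtain ⟨a, b, c, -, -, -, -, -, -, rfl⟩ := mem_cherries.1 hp
    exact hAs (hps (by simp))
  · intro p hp hps
    obtain ⟨a, b, -, -, -, rfl⟩ := mem_lowEdges.1 hp
    exact hAs (hps (by simp))

lemma ptHEquiv_FprecLT (hA : A ⊆ Icc 1 m) (hz : z ∈ A) (hmax : ∀ x ∈ A, x ≤ z)
    (x : (VRc (FprecLT m A) 2).space) :
    PtHEquiv x (AbsSC.incl subset_noLowEdge x : (noLowEdge m z A).space) := by
  have hz0 : 0 < z := (Finset.mem_Icc.1 (hA hz)).1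
  refine AbsSC.ptHEquiv_incl_of_remove_finset {{A}} (by simp) ?_ ?_ _ x
  · intro p hp
    obtain rfl := Finset.mem_singleton.1 hp
    refine ⟨toggle A {0, z}, by simpa using toggle_ne_self hz0.ne, fun s hs hps => ?_⟩
    have hAs : A ∈ s := hps (by simp)
    refine AbsSC.insert_mem_avoid hs (toggle_notMem_of_mem_lowEdges hz0)
      (AbsSC.insert_mem_avoid hs.1 (toggle_notMem_of_mem_cherries hz0)
      (AbsSC.insert_mem_avoid hs.1.1 (toggle_notMem_of_mem_cells hz0)
      (insert_toggle_mem_faces hA hz hs.1.1.1 hAs hz0 fun e f hef h => ?_)))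
    by_contra h'
    have hf := hmax f (mem_of_toggle_mem_face hs.1.1.1 hef h)
    refine hs.2 _ (mem_lowEdges.2 ⟨e, f, by omega, by omega, hef.ne, rfl⟩) ?_
    intro B hB
    simp only [Finset.mem_insert, Finset.mem_singleton] at hB
    rcases hB with rfl | rfl <;> assumption
  · intro s
    constructor
    · intro hs
      refine ⟨subset_noLowEdge hs, ?_⟩
      simp only [Finset.mem_singleton, forall_eq, Finset.singleton_subset_iff]
      exact fun h => precLT_irrefl A (hs.2.1 A h).2
    · rintro ⟨hs, h⟩
      simp only [Finset.mem_singleton, forall_eq, Finset.singleton_subset_iff] at h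
      obtain ⟨h1, h2, h3⟩ := hs.1.1.1
      refine ⟨h1, fun B hB => ⟨(h2 B hB).1, (h2 B hB).2.resolve_right ?_⟩, h3⟩
      rintro rfl
      exact h hB

end Collapse

section CellComplex

variable {m z : ℕ} {A : Finset ℕ}

lemma card_pair_symmDiff_cellIdx (S : Finset (Fin 4)) (i j : Fin 4) :
    (symmDiff (if i ∈ S then cellIdx i else (cellIdx i)ᶜ)
      (if j ∈ S then cellIdx j else (cellIdx j)ᶜ)).card ≤ 2 := by
  by_cases hi : i ∈ S <;> by_cases hj : j ∈ S <;> simp only [hi, hj, if_true, if_false]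
  · exact (by decide : ∀ i j, (symmDiff (cellIdx i) (cellIdx j)).card ≤ 2) i j
  · exact (by decide : ∀ i j, i ≠ j → (symmDiff (cellIdx i) (cellIdx j)ᶜ).card ≤ 2) i j
      fun h => hj (h ▸ hi)
  · exact (by decide : ∀ i j, i ≠ j → (symmDiff (cellIdx i)ᶜ (cellIdx j)).card ≤ 2) i j
      fun h => hi (h ▸ hj)
  · exact (by decide : ∀ i j, (symmDiff (cellIdx i)ᶜ (cellIdx j)ᶜ).card ≤ 2) i j

lemma cellVert_mem_FprecLE (hA : A ⊆ Icc 1 m) {t : ℕ × ℕ × ℕ} (ht : t ∈ triples A z)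
    (k : Fin 4) : cellVert A z t k ∈ FprecLE m A := by
  obtain ⟨p, q, r⟩ := t
  have hc : cellVert A z (p, q, r) k ∈ cell A z (p, q, r) := Finset.mem_image_of_mem _ (mem_univ k)
  rw [mem_triples] at ht
  rw [mem_cell] at hc
  rcases hc with h | h | h | h
  · rw [h]
    exact ⟨hA, Or.inr rfl⟩
  all_goals
    rw [h]
    exact (toggle_mem_FprecLT hA (by omega) (by tauto)).imp_right Or.inl

lemma toggle_four {p q r z : ℕ} (hpq : p < q) (hqr : q < r) (hrz : r < z) :
    toggle A {p, q, r, z} = toggle (toggle A {r, z}) {p, q} := by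
  ext x
  simp only [toggle, Finset.mem_symmDiff, Finset.mem_erase, Finset.mem_insert,
    Finset.mem_singleton]
  grind

lemma cellOpp_mem_FprecLE (hA : A ⊆ Icc 1 m) (hz : z ∈ A) {t : ℕ × ℕ × ℕ} (ht : t ∈ triples A z)
    (k : Fin 4) : cellOpp A z t k ∈ FprecLE m A := by
  obtain ⟨p, q, r⟩ := t
  rw [mem_triples] at ht
  have h : cellOpp A z (p, q, r) k = toggle (toggle A {r, z}) {p, q} ∨
      ∃ x < z, cellOpp A z (p, q, r) k = toggle A {x, z} := by
    rw [← toggle_four ht.1 ht.2.1 ht.2.2.1]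
    have h0 : (cellIdx 0)ᶜ = univ := by decide
    have h1 : (cellIdx 1)ᶜ = {2, 3} := by decide
    have h2 : (cellIdx 2)ᶜ = {1, 3} := by decide
    have h3 : (cellIdx 3)ᶜ = {0, 3} := by decide
    fin_cases k
    · left
      simp only [cellOpp, Fin.zero_eta, h0]
      congr 1
      ext x
      simp [Fin.exists_fin_succ, eq_comm]
    · exact Or.inr ⟨r, by omega, by simp [cellOpp, h1]⟩
    · exact Or.inr ⟨q, by omega, by simp [cellOpp, h2]⟩
    · exact Or.inr ⟨p, by omega, by simp [cellOpp, h3]⟩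
  rcases h with h | ⟨x, hx, h⟩
  · have h1 := toggle_mem_FprecLT hA ht.2.2.1 hz
    have h2 := toggle_mem_FprecLT h1.1 ht.1 (by
      rw [mem_toggle (by omega)]
      simp [ht.2.2.2.1]
      omega)
    rw [h]
    exact ⟨h2.1, Or.inl (h2.2.trans h1.2)⟩
  · rw [h]
    exact (toggle_mem_FprecLT hA hx hz).imp_right Or.inl

lemma cell_mem_faces (hA : A ⊆ Icc 1 m) (hz : z ∈ A) {t : ℕ × ℕ × ℕ} (ht : t ∈ triples A z)
    (S : Finset (Fin 4)) :
    univ.image (fun k => if k ∈ S then cellVert A z t k else cellOpp A z t k) ∈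
      (VRc (FprecLE m A) 2).faces := by
  refine ⟨by simp, fun B hB => ?_, fun B hB C hC => ?_⟩
  · obtain ⟨k, -, rfl⟩ := Finset.mem_image.1 hB
    split_ifs
    exacts [cellVert_mem_FprecLE hA ht k, cellOpp_mem_FprecLE hA hz ht k]
  · obtain ⟨i, -, rfl⟩ := Finset.mem_image.1 hB
    obtain ⟨j, -, rfl⟩ := Finset.mem_image.1 hC
    have key : ∀ k, (if k ∈ S then cellVert A z t k else cellOpp A z t k) =
        toggle A ((if k ∈ S then cellIdx k else (cellIdx k)ᶜ).image ![t.1, t.2.1, t.2.2, z]) := by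
      intro k
      split_ifs <;> rfl
    have hev : ∀ k, Even (if k ∈ S then cellIdx k else (cellIdx k)ᶜ).card := by
      intro k
      split_ifs
      exacts [even_card_cellIdx k, even_card_compl_cellIdx k]
    rw [key, key, card_symmDiff_toggle_le_two (even_card_image_cellPts ht (hev i))
      (even_card_image_cellPts ht (hev j)), ← Finset.image_symmDiff _ _ (injective_cellPts ht),
      Finset.card_image_of_injective _ (injective_cellPts ht)]
    exact card_pair_symmDiff_cellIdx S i j

lemma cellOpp_notMem_cell {t : ℕ × ℕ × ℕ} (ht : t ∈ triples A z) {t' : ℕ × ℕ × ℕ}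
    (ht' : t' ∈ triples A z) (k : Fin 4) : cellOpp A z t k ∉ cell A z t' := by
  intro h
  obtain ⟨j, -, hj⟩ := Finset.mem_image.1 h
  have h1 := toggle_inj (even_card_image_cellPts ht' (even_card_cellIdx j))
    (even_card_image_cellPts ht (even_card_compl_cellIdx k)) hj
  have h2 : z ∈ (cellIdx k)ᶜ.image ![t.1, t.2.1, t.2.2, z] :=
    Finset.mem_image.2 ⟨3, (by decide : ∀ k, 3 ∈ (cellIdx k)ᶜ) k, rfl⟩
  rw [← h1, Finset.mem_image] at h2
  obtain ⟨l, hl, hlz⟩ := h2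
  obtain rfl : l = 3 := injective_cellPts ht' hlz
  revert hl
  exact (by decide : ∀ j, 3 ∉ cellIdx j) j

lemma eq_of_cell_eq_cell {t t' : ℕ × ℕ × ℕ} (ht : t ∈ triples A z) (ht' : t' ∈ triples A z)
    (h : cell A z t = cell A z t') : t = t' := by
  obtain ⟨p, q, r⟩ := t
  obtain ⟨p', q', r'⟩ := t'
  rw [mem_triples] at ht ht'
  have key : ∀ {x y : ℕ}, x ≠ y → toggle A {x, y} ∈ cell A z (p', q', r') →
      (x = p' ∨ x = q' ∨ x = r') ∧ (y = p' ∨ y = q' ∨ y = r') := by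
    intro x y hxy h
    have aux : ∀ {a b : ℕ}, a ≠ b → toggle A {x, y} = toggle A {a, b} →
        (x = a ∨ x = b) ∧ (y = a ∨ y = b) := by
      intro a b hab h
      have h' := toggle_inj (even_card_pair hxy) (even_card_pair hab) h
      constructor
      · have : x ∈ ({a, b} : Finset ℕ) := h' ▸ (by simp)
        simpa using this
      · have : y ∈ ({a, b} : Finset ℕ) := h' ▸ (by simp)
        simpa using this
    rcases mem_cell.1 h with h | h | h | h
    · exact absurd h (toggle_ne_self hxy)
    · have := aux (by omega) h
      omega
    · have := aux (by omega) h
      omega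
    · have := aux (by omega) h
      omega
  have k1 := key (x := p) (y := q) (by omega)
    (h ▸ mem_cell.2 (by simp))
  have k2 := key (x := q) (y := r) (by omega)
    (h ▸ mem_cell.2 (by simp))
  simp only [Prod.mk.injEq]
  omega

/-- The tetrahedral cells of the Vietoris–Rips complex of `F_{⪯ A}`. -/
noncomputable def cellData (hA : A ⊆ Icc 1 m) (hz : z ∈ A) {r : ℕ} (hr : (triples A z).card = r) :
    AbsSC.CellData (noCell m z A) (VRc (FprecLE m A) 2) r where
  vert i := cellVert A z ((triples A z).equivFinOfCardEq hr |>.symm i)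
  opp i := cellOpp A z ((triples A z).equivFinOfCardEq hr |>.symm i)
  vert_injective i := cellVert_injective (Subtype.coe_prop _)
  eq_of_image_eq i j h := ((triples A z).equivFinOfCardEq hr).symm.injective
    (Subtype.ext (eq_of_cell_eq_cell (Subtype.coe_prop _) (Subtype.coe_prop _) h))
  notMem i h := h.2 _ (Finset.mem_image_of_mem _ (Subtype.coe_prop _)) subset_rfl
  mem_iff s := by
    constructor
    · intro hs
      by_cases h : ∃ t ∈ triples A z, cell A z t ⊆ s
      · obtain ⟨t, ht, hts⟩ := h
        refine Or.inr ⟨(triples A z).equivFinOfCardEq hr ⟨t, ht⟩, ?_⟩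
        simpa [cell] using eq_cell_of_subset hA ht hs hts
      · push Not at h
        refine Or.inl ⟨hs, fun p hp => ?_⟩
        obtain ⟨t, ht, rfl⟩ := Finset.mem_image.1 hp
        exact h t ht
    · rintro (hs | ⟨i, rfl⟩)
      · exact hs.1
      · simpa using cell_mem_faces hA hz
          (Subtype.coe_prop ((triples A z).equivFinOfCardEq hr |>.symm i)) univ
  mixed i S hS := by
    have ht := Subtype.coe_prop ((triples A z).equivFinOfCardEq hr |>.symm i)
    have hf := cell_mem_faces hA hz ht S
    refine ⟨hf, fun p hp hps => ?_⟩
    obtain ⟨t, ht', rfl⟩ := Finset.mem_image.1 hp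
    obtain ⟨k, hk⟩ : ∃ k, k ∉ S := by
      by_contra! h
      exact hS (Finset.eq_univ_iff_forall.2 h)
    have heq := eq_cell_of_subset hA ht' hf hps
    refine cellOpp_notMem_cell ht ht' k ?_
    rw [← heq]
    exact Finset.mem_image.2 ⟨k, mem_univ k, if_neg hk⟩

lemma finite_noCell : (noCell m z A).faces.Finite := by
  refine (Finset.finite_toSet ((Icc 1 m).powerset.powerset)).subset fun s hs => ?_
  exact Finset.mem_powerset.2 fun B hB => Finset.mem_powerset.2 (hs.1.2.1 B hB).1

lemma mem_noCell_of_card {s : Finset (Finset ℕ)} (hs : s ∈ (VRc (FprecLE m A) 2).faces)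
    (h : s.card < 4) : s ∈ (noCell m z A).faces := by
  refine ⟨hs, fun p hp hps => ?_⟩
  obtain ⟨t, ht, rfl⟩ := Finset.mem_image.1 hp
  have := Finset.card_le_card hps
  rw [cell, Finset.card_image_of_injective _ (cellVert_injective ht)] at this
  simp at this
  omega

lemma singleton_mem_VRc {F : Set (Finset ℕ)} {v : Finset ℕ} {r : ℕ} :
    {v} ∈ (VRc F r).faces ↔ v ∈ F := by
  constructor
  · intro h
    exact h.2.1 v (by simp)
  · intro h
    refine ⟨by simp, by simpa, by simp⟩

lemma precLE_of_subset {B C : Finset ℕ} (h : precLE B A) (hCB : C ⊆ B) : precLE C A := by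
  rcases hCB.eq_or_ssubset with rfl | hCB
  · exact h
  · rw [precLE_iff] at h ⊢
    exact ((precLT_iff.1 (precLT_of_card_lt (Finset.card_lt_card hCB))).trans_le h).le

lemma joined_noCell (v : Finset ℕ) (hv : {v} ∈ (noCell m z A).faces)
    (h0 : {∅} ∈ (noCell m z A).faces) :
    Joined ((noCell m z A).pt v hv) ((noCell m z A).pt ∅ h0) := by
  induction v using Finset.induction_on with
  | empty => exact Joined.refl _
  | insert b C hb ih =>
    have h1 := singleton_mem_VRc.1 hv.1
    have h2 : C ∈ FprecLE m A :=
      ⟨(Finset.subset_insert _ _).trans h1.1, precLE_of_subset h1.2 (Finset.subset_insert _ _)⟩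
    have hC : {C} ∈ (noCell m z A).faces :=
      mem_noCell_of_card (singleton_mem_VRc.2 h2) (by simp)
    refine (AbsSC.joined_pt_of_edge (mem_noCell_of_card ⟨by simp, ?_, ?_⟩ ?_) hv hC).trans (ih hC)
    · simp [h1, h2]
    · have h3 : symmDiff (insert b C) C = {b} := by
        ext x
        simp only [Finset.mem_symmDiff, Finset.mem_insert, Finset.mem_singleton]
        grind
      simp [h3, symmDiff_comm C]
    · exact Finset.card_le_two.trans_lt (by norm_num)

lemma ptHEquiv_FprecLE (hA : A ⊆ Icc 1 m) (hz : z ∈ A) (hmax : ∀ x ∈ A, x ≤ z) {r : ℕ}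
    (hr : (triples A z).card = r) (hL : {∅} ∈ (VRc (FprecLT m A) 2).faces)
    (hK : {∅} ∈ (VRc (FprecLE m A) 2).faces) {Y : Type} [TopologicalSpace Y] {y : Y}
    (h : PtHEquiv ((VRc (FprecLT m A) 2).pt ∅ hL) y) :
    PtHEquiv ((VRc (FprecLE m A) 2).pt ∅ hK) (Wedge2.inr (wedgeSphPt 3 r) y y) := by
  have h1 := ptHEquiv_FprecLT hA hz hmax ((VRc (FprecLT m A) 2).pt ∅ hL)
  have h2 := h1.trans (ptHEquiv_noLowEdge hA hz hmax _)
  have h3 := h2.trans (ptHEquiv_noCherry hA hz _)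
  have h0 : {∅} ∈ (noCell m z A).faces := mem_noCell_of_card hK (by simp)
  have h4 : PtHEquiv ((noCell m z A).pt ∅ h0) y := h3.symm.trans h
  exact (cellData hA hz hr).ptHEquiv_wedge2 finite_noCell _
    (fun v hv => joined_noCell v hv h0) y h4

end CellComplex

section Count

lemma rA_eq_sum_range (A : Finset ℕ) : rA A = ∑ k ∈ range (A.card - 1), k.choose 2 +
    ∑ j ∈ range (A.card - 2), ((A.sort (· ≤ ·)).getD j 0 -
      (if j = 0 then 0 else (A.sort (· ≤ ·)).getD (j - 1) 0 + 1)) * (A.card - (j + 1)).choose 2 := by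
  rw [rA]
  congr 1
  · refine Finset.sum_subset (fun k hk => ?_) fun k hk hk' => ?_
    · simp only [Finset.mem_Icc, Finset.mem_range] at *
      omega
    · simp only [Finset.mem_Icc, Finset.mem_range] at *
      exact Nat.choose_eq_zero_of_lt (by omega)
  · refine (Finset.sum_bij (fun j _ => j + 1) ?_ ?_ ?_ ?_).symm
    · intro j hj
      simp only [Finset.mem_Icc, Finset.mem_range] at *
      omega
    · intro i _ j _ h
      omega
    · intro l hl
      simp only [Finset.mem_Icc] at hl
      exact ⟨l - 1, by simp; omega, by omega⟩
    · intro j _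
      rcases j with - | j
      · simp
      · simp

lemma rA_insert {A : Finset ℕ} {a : ℕ} (ha : ∀ x ∈ A, a < x) (hA : A.Nonempty) :
    rA (insert a A) = rA A + a * (A.card - 1) := by
  have ha' : a ∉ A := fun h => (ha a h).false
  rw [rA_eq_sum_range, rA_eq_sum_range, Finset.card_insert_of_notMem ha',
    Finset.sort_insert _ (fun x hx => (ha x hx).le) ha']
  have hlen := Finset.length_sort (s := A) (· ≤ ·)
  have hmem : ∀ x, x ∈ A.sort (· ≤ ·) ↔ x ∈ A := fun x => Finset.mem_sort _
  generalize A.sort (· ≤ ·) = l at *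
  cases l with
  | nil =>
    rw [List.length_nil] at hlen
    exact absurd hA.card_pos (by omega)
  | cons b l =>
  have hb : a < b := ha b ((hmem b).1 (by simp))
  obtain ⟨n, hn⟩ : ∃ n, A.card = n + 1 := ⟨A.card - 1, by have := hA.card_pos; omega⟩
  rw [hn]
  rcases n with - | - | n
  · simp
  · simp [Finset.sum_range_succ]
  · obtain ⟨c, rfl⟩ : ∃ c, b = a + 1 + c := ⟨b - (a + 1), by omega⟩
    simp only [show n + 1 + 1 + 1 + 1 - 1 = n + 2 + 1 by omega,
      show n + 1 + 1 + 1 + 1 - 2 = n + 1 + 1 by omega, show n + 1 + 1 + 1 - 1 = n + 2 by omega,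
      show n + 1 + 1 + 1 - 2 = n + 1 by omega]
    rw [Finset.sum_range_succ (fun k => k.choose 2) (n + 2)]
    generalize ∑ k ∈ range (n + 2), k.choose 2 = c₀
    simp only [Finset.sum_range_succ']
    have h1 : (n + 3).choose 2 = (n + 2) + (n + 2).choose 2 := by
      rw [Nat.choose_succ_succ' (n + 2) 1]
      simp
    have h2 : ∀ j, n + 1 + 1 + 1 - (j + 1 + 1) = n + 1 - j := by
      intro j
      omega
    simp [h1, h2]
    ring

lemma card_triples {A : Finset ℕ} {z : ℕ} (hz : z ∈ A) (hmax : ∀ x ∈ A, x ≤ z) :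
    (triples A z).card = rA A := by
  induction A using Finset.induction_on_min with
  | empty => simp at hz
  | insert a A ha ih =>
    have ha' : a ∉ A := fun h => (ha a h).false
    rcases A.eq_empty_or_nonempty with rfl | hA
    · have : rA (insert a ∅) = 0 := by simp [rA]
      rw [this, Finset.card_eq_zero, Finset.eq_empty_iff_forall_notMem]
      rintro ⟨p, q, r⟩ h
      rw [mem_triples] at h
      simp at h hz
      omega
    · have hzA : z ∈ A := by
        rcases Finset.mem_insert.1 hz with rfl | h
        · obtain ⟨x, hx⟩ := hA
          have := ha x hx
          have := hmax x (by simp [hx])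
          omega
        · exact h
      have hmax' : ∀ x ∈ A, x ≤ z := fun x hx => hmax x (by simp [hx])
      have h : triples (insert a A) z = triples A z ∪
          (range a ×ˢ A.erase z).image fun t => (t.1, a, t.2) := by
        ext ⟨p, q, r⟩
        simp only [Finset.mem_union, mem_triples, Finset.mem_image, Finset.mem_product,
          Finset.mem_range, Finset.mem_erase, Finset.mem_insert, Prod.mk.injEq, Prod.exists]
        constructor
        · rintro ⟨hpq, hqr, hr, rfl | hq, hr'⟩
          · exact Or.inr ⟨p, r, ⟨hpq, by omega, by grind⟩, rfl, rfl, rfl⟩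
          · exact Or.inl ⟨hpq, hqr, hr, hq, by grind⟩
        · rintro (h | ⟨p, r, ⟨hp, hrz, hr⟩, rfl, rfl, rfl⟩)
          · tauto
          · have := hmax' r hr
            exact ⟨hp, ha r hr, by omega, by simp, by simp [hr]⟩
      have hd : Disjoint (triples A z) ((range a ×ˢ A.erase z).image fun t => (t.1, a, t.2)) := by
        rw [Finset.disjoint_left]
        rintro ⟨p, q, r⟩ h1 h2
        rw [mem_triples] at h1
        simp only [Finset.mem_image, Prod.mk.injEq] at h2
        obtain ⟨t, -, -, rfl, -⟩ := h2
        exact ha' h1.2.2.2.1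
      rw [h, Finset.card_union_of_disjoint hd, ih hzA hmax', rA_insert ha hA,
        Finset.card_image_of_injective, Finset.card_product, Finset.card_range,
        Finset.card_erase_of_mem hzA]
      rintro ⟨x, y⟩ ⟨x', y'⟩ h
      simpa using h

end Count

section Induction

variable {m : ℕ} {A : Finset ℕ}

lemma singleton_empty_mem_FprecLT (hA : A.Nonempty) : {∅} ∈ (VRc (FprecLT m A) 2).faces :=
  singleton_mem_VRc.2 ⟨by simp, precLT_of_card_lt (by simpa using hA)⟩

lemma singleton_empty_mem_FprecLE (hA : A.Nonempty) : {∅} ∈ (VRc (FprecLE m A) 2).faces :=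
  singleton_mem_VRc.2 ⟨by simp, Or.inl (precLT_of_card_lt (by simpa using hA))⟩

lemma ptHEquiv_wedge2_of_FprecLT (hA : A ⊆ Icc 1 m) (hne : A.Nonempty)
    {Y : Type} [TopologicalSpace Y] {y : Y}
    (h : PtHEquiv ((VRc (FprecLT m A) 2).pt ∅ (singleton_empty_mem_FprecLT hne)) y) :
    PtHEquiv ((VRc (FprecLE m A) 2).pt ∅ (singleton_empty_mem_FprecLE hne))
      (Wedge2.inr (wedgeSphPt 3 (rA A)) y y) :=
  ptHEquiv_FprecLE hA (A.max'_mem hne) (fun x hx => A.le_max' x hx)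
    (card_triples (A.max'_mem hne) fun x hx => A.le_max' x hx) _ _ h

lemma precLE_one_two_three {B : Finset ℕ} (hB : B ⊆ Icc 1 m) (h : 3 ≤ B.card) :
    precLE {1, 2, 3} B := by
  rw [precLE_iff, ← not_lt, ← precLT_iff]
  have hs : ({1, 2, 3} : Finset ℕ).sort (· ≤ ·) = [1, 2, 3] := by
    rw [Finset.sort_insert, Finset.sort_insert, Finset.sort_singleton] <;> simp
  rintro (h' | ⟨h', hl⟩)
  · have : ({1, 2, 3} : Finset ℕ).card = 3 := rfl
    omega
  · have hlen := Finset.length_sort (s := B) (· ≤ ·)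
    have hsort := Finset.sortedLT_sort B
    have hmem : ∀ x ∈ B.sort (· ≤ ·), 1 ≤ x := fun x hx =>
      (Finset.mem_Icc.1 (hB ((Finset.mem_sort _).1 hx))).1
    rw [hs] at hl
    rw [h', show ({1, 2, 3} : Finset ℕ).card = 3 from rfl] at hlen
    obtain ⟨a, b, c, habc⟩ := List.length_eq_three.1 hlen
    rw [habc] at hl hsort hmem
    have := hsort.pairwise
    have h1 := hmem a (by simp)
    simp [List.cons_lex_cons_iff] at hl this
    omega

lemma subsingleton_VRc_singleton (C : Finset ℕ) (r : ℕ) :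
    Subsingleton (VRc {C} r).space := by
  have key : ∀ f : (VRc {C} r).space, ∀ v, f.wt v = if v = C then 1 else 0 := by
    intro f v
    obtain ⟨s, hs, h1, h2⟩ := AbsSC.exists_support f
    have hsC : s = {C} := Finset.eq_singleton_iff_nonempty_unique_mem.2 ⟨hs.1, hs.2.1⟩
    subst hsC
    split_ifs with h
    · subst h
      simpa using h2
    · by_contra h'
      exact h (by simpa using (h1 v).2 h')
  exact ⟨fun f g => AbsSC.space_ext (funext fun v => by rw [key, key])⟩

lemma ptHEquiv_FprecLT_one_two_three {h : {∅} ∈ (VRc (FprecLT m {1, 2, 3}) 2).faces} :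
    PtHEquiv ((VRc (FprecLT m {1, 2, 3}) 2).pt ∅ h) (wedgeSphPt 3 0) := by
  have h0 : {∅} ∈ (VRc {∅} 2).faces := singleton_mem_VRc.2 rfl
  have hcard : ∀ B ∈ FprecLT m {1, 2, 3}, B.card ≤ 2 := by
    intro B hB
    by_contra! h
    have := precLE_one_two_three hB.1 h
    rw [precLE_iff] at this
    exact this.not_gt (precLT_iff.1 hB.2)
  have hmem : (∅ : Finset ℕ) ∈ FprecLT m {1, 2, 3} := singleton_mem_VRc.1 h
  have hsub : (VRc {∅} 2).faces ⊆ (VRc (FprecLT m {1, 2, 3}) 2).faces := fun s hs =>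
    ⟨hs.1, fun B hB => by rw [hs.2.1 B hB]; exact hmem, hs.2.2⟩
  have h1 : PtHEquiv ((VRc {∅} 2).pt ∅ h0) ((VRc (FprecLT m {1, 2, 3}) 2).pt ∅ h) := by
    refine AbsSC.ptHEquiv_incl_of_remove_finset
      (((Icc 1 m).powerset.erase ∅).image fun B => {B}) ?_ ?_ ?_ hsub _
    · intro p hp
      obtain ⟨B, -, rfl⟩ := Finset.mem_image.1 hp
      simp
    · intro p hp
      refine ⟨∅, fun p' hp' => ?_, fun s hs _ => ⟨by simp, fun B hB => ?_, fun B hB C hC => ?_⟩⟩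
      · obtain ⟨B, hB, rfl⟩ := Finset.mem_image.1 hp'
        simpa [eq_comm] using (Finset.mem_erase.1 hB).1
      · rcases Finset.mem_insert.1 hB with rfl | hB
        exacts [hmem, hs.2.1 B hB]
      · rcases Finset.mem_insert.1 hB with rfl | hB <;> rcases Finset.mem_insert.1 hC with rfl | hC
        · simp
        · simpa [← Finset.bot_eq_empty] using hcard C (hs.2.1 C hC)
        · simpa [← Finset.bot_eq_empty] using hcard B (hs.2.1 B hB)
        · exact hs.2.2 B hB C hC
    · intro s
      constructor
      · intro hs
        refine ⟨hsub hs, fun p hp hps => ?_⟩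
        obtain ⟨B, hB, rfl⟩ := Finset.mem_image.1 hp
        exact (Finset.mem_erase.1 hB).1 (hs.2.1 B (hps (by simp)))
      · rintro ⟨hs, h⟩
        refine ⟨hs.1, fun B hB => ?_, hs.2.2⟩
        by_contra hB0
        refine h {B} (Finset.mem_image_of_mem _ (Finset.mem_erase.2 ⟨hB0, ?_⟩)) (by simpa)
        exact Finset.mem_powerset.2 (hs.2.1 B hB).1
  have := subsingleton_VRc_singleton ∅ 2
  let e : (VRc {∅} 2).space ≃ₜ WedgeSph 3 0 :=
    { toFun := fun _ => wedgeSphPt 3 0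
      invFun := fun _ => (VRc {∅} 2).pt ∅ h0
      left_inv := fun _ => Subsingleton.elim _ _
      right_inv := fun w => by
        rcases Wedge.eq_pt_or_inj w with rfl | ⟨p, -⟩
        · rfl
        · exact p.1.elim0
      continuous_toFun := continuous_const
      continuous_invFun := continuous_const }
  exact h1.symm.trans (PtHEquiv.of_homeomorph e _)

open scoped Classical in
lemma sum_filter_precLE (f : Finset ℕ → ℕ) (hA : A ⊆ Icc 1 m) (h3 : precLE {1, 2, 3} A) :
    ∑ B ∈ (Icc 1 m).powerset.filter (fun B => precLE {1, 2, 3} B ∧ precLE B A), f B =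
      f A + ∑ B ∈ (Icc 1 m).powerset.filter (fun B => precLE {1, 2, 3} B ∧ precLT B A), f B := by
  rw [← Finset.sum_insert]
  · congr 1
    ext B
    simp only [Finset.mem_filter, Finset.mem_powerset, Finset.mem_insert, precLE.eq_def B A]
    constructor
    · tauto
    · rintro (rfl | h) <;> tauto
  · simp [precLT_irrefl]

lemma exists_predecessor (hA : A ⊆ Icc 1 m) (h : precLT {1, 2, 3} A) :
    ∃ A' ⊆ Icc 1 m, precLE {1, 2, 3} A' ∧ precLT A' A ∧
      ∀ B ⊆ Icc 1 m, precLT B A ↔ precLE B A' := by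
  classical
  have h3 : 3 ≤ m := by
    have h1 := card_le_of_precLE (Or.inl h)
    have h2 := Finset.card_le_card hA
    rw [Nat.card_Icc] at h2
    have : ({1, 2, 3} : Finset ℕ).card = 3 := rfl
    omega
  have h123 : ({1, 2, 3} : Finset ℕ) ⊆ Icc 1 m := by
    intro x hx
    simp at hx ⊢
    omega
  obtain ⟨A', hA', hmax⟩ := Finset.exists_max_image
    ((Icc 1 m).powerset.filter fun B => precLT B A) precKey ⟨{1, 2, 3}, by simpa [h123] using h⟩
  simp only [Finset.mem_filter, Finset.mem_powerset] at hA' hmax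
  refine ⟨A', hA'.1, precLE_iff.2 (hmax _ ⟨h123, h⟩), hA'.2, fun B hB => ⟨fun hBA => ?_, fun hBA => ?_⟩⟩
  · exact precLE_iff.2 (hmax B ⟨hB, hBA⟩)
  · rw [precLT_iff]
    exact (precLE_iff.1 hBA).trans_lt (precLT_iff.1 hA'.2)

open scoped Classical in
lemma ptHEquiv_FprecLE_wedgeSph (hA : A ⊆ Icc 1 m) (hcard : 3 ≤ A.card)
    (hK : {∅} ∈ (VRc (FprecLE m A) 2).faces) :
    PtHEquiv ((VRc (FprecLE m A) 2).pt ∅ hK) (wedgeSphPt 3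
      (∑ B ∈ (Icc 1 m).powerset.filter (fun B => precLE {1, 2, 3} B ∧ precLE B A), rA B)) := by
  induction hn : ((Icc 1 m).powerset.filter fun B => precLT B A).card using Nat.strong_induction_on
    generalizing A with
  | _ n ih =>
    have hne : A.Nonempty := Finset.card_pos.1 (by omega)
    have h3 := precLE_one_two_three hA hcard
    rw [sum_filter_precLE rA hA h3]
    refine (ptHEquiv_wedge2_of_FprecLT hA hne ?_).trans (ptHEquiv_wedge2_wedge _ _ _)
    rcases h3 with h3 | rfl
    · obtain ⟨A', hA', h3', hlt, hiff⟩ := exists_predecessor hA h3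
      have hF : FprecLT m A = FprecLE m A' := by
        ext B
        exact and_congr_right fun hB => hiff B hB
      have hS : (Icc 1 m).powerset.filter (fun B => precLE {1, 2, 3} B ∧ precLT B A) =
          (Icc 1 m).powerset.filter (fun B => precLE {1, 2, 3} B ∧ precLE B A') :=
        Finset.filter_congr fun B hB => and_congr_right fun _ => hiff B (Finset.mem_powerset.1 hB)
      have key : ∀ F, F = FprecLE m A' → ∀ h : {∅} ∈ (VRc F 2).faces,
          PtHEquiv ((VRc F 2).pt ∅ h) (wedgeSphPt 3 (∑ B ∈ (Icc 1 m).powerset.filter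
            (fun B => precLE {1, 2, 3} B ∧ precLE B A'), rA B)) := by
        rintro _ rfl h
        refine ih _ ?_ hA' (card_le_of_precLE h3') h rfl
        rw [← hn]
        refine Finset.card_lt_card ((Finset.ssubset_iff_of_subset ?_).2 ⟨A', ?_⟩)
        · intro B hB
          simp only [Finset.mem_filter] at hB ⊢
          exact ⟨hB.1, hB.2.trans hlt⟩
        · simp [hA', hlt, precLT_irrefl]
      rw [hS]
      exact key _ hF _
    · have hS : (Icc 1 m).powerset.filter
          (fun B => precLE {1, 2, 3} B ∧ precLT B {1, 2, 3}) = ∅ := by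
        refine Finset.filter_eq_empty_iff.2 fun B _ h => ?_
        rw [precLE_iff, precLT_iff] at h
        exact h.1.not_gt h.2
      rw [hS]
      exact ptHEquiv_FprecLT_one_two_three

end Induction

open scoped Classical in
/-- For `m ≥ n > 2` and `A = i_1 ⋯ i_n ⊆ [m]` with `{1,2,3} ≺ A`,
`VR(F^m_{⪯A}, 2) ≃ (∨_{r_A} S³) ∨ VR(F^m_{≺A}, 2)`; consequently, for any `A ⊆ [m]` with
`|A| ≥ 3`, `VR(F^m_{⪯A}, 2)` is homotopy equivalent to a wedge of
`Σ{r_B : {1,2,3} ⪯ B ⪯ A}` copies of `S³`. -/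
theorem stmt14 (m : ℕ) :
    (∀ (n : ℕ) (A : Finset ℕ), 2 < n → n ≤ m → A ⊆ Finset.Icc 1 m → A.card = n →
      precLT {1, 2, 3} A →
      ∃ y : (VRc (FprecLT m A) 2).space,
        Nonempty (ContinuousMap.HomotopyEquiv ((VRc (FprecLE m A) 2).space)
          (Wedge2 (WedgeSph 3 (rA A)) ((VRc (FprecLT m A) 2).space)
            (wedgeSphPt 3 (rA A)) y))) ∧
    (∀ A : Finset ℕ, A ⊆ Finset.Icc 1 m → 3 ≤ A.card →
      AbsSC.HEquivTop (VRc (FprecLE m A) 2)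
        (WedgeSph 3 (∑ B ∈ (Finset.Icc 1 m).powerset.filter
          (fun B => precLE {1, 2, 3} B ∧ precLE B A), rA B))) := by
  refine ⟨fun n A hn _ hA hcard _ => ?_, fun A hA hcard => ?_⟩
  · have hne : A.Nonempty := Finset.card_pos.1 (by omega)
    exact ⟨_, (ptHEquiv_wedge2_of_FprecLT hA hne
      (PtHEquiv.of_homeomorph (Homeomorph.refl _) _)).nonempty_homotopyEquiv⟩
  · exact (ptHEquiv_FprecLE_wedgeSph hA hcard
      (singleton_empty_mem_FprecLE (Finset.card_pos.1 (by omega)))).nonempty_homotopyEquiv
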